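/- arXiv:alg-geom/9610009 — 2 statements merged into one kernel-verified Lean document; each statement's English description precedes it below -/
import Mathlib

section
/- Let k be a field of prime characteristic p and let d ≥ 2 be an integer. Then there exists a nonzero homogeneous polynomial f ∈ k[x,y,z] of degree d such that the sequence (dim_k k[x,y,z]/(f, x^{pⁿ}, y^{pⁿ}, z^{pⁿ}))/p^{2n} converges to 3d/4 as n → ∞; that is, there is a plane curve of degree d whose Hilbert-Kunz multiplicity equals 3d/4, the minimal possible value for plane curves of degree d. -/
open MvPolynomial

/-- The ideal of `k[x,y,z]` generated by the `q`-th powers of the variables. -/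
noncomputable def powIdeal (k : Type*) [Field k] (q : ℕ) : Ideal (MvPolynomial (Fin 3) k) :=
  Ideal.span (Set.range fun i => X i ^ q)

/-- Exponent vectors of total degree less than `m` all of whose entries are less than `q`. -/
noncomputable def boxBelow (q m : ℕ) : Finset (Fin 3 →₀ ℕ) :=
  (Finset.univ.finsupp fun _ => Finset.range q).filter fun u => u.degree < m

theorem mem_boxBelow {q m : ℕ} {u : Fin 3 →₀ ℕ} :
    u ∈ boxBelow q m ↔ (∀ i, u i < q) ∧ u.degree < m := by
  simp [boxBelow, Finset.mem_finsupp_iff]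

section Count

variable {k : Type*} [Field k]

theorem mem_powIdeal_iff {q : ℕ} {h : MvPolynomial (Fin 3) k} :
    h ∈ powIdeal k q ↔ ∀ u : Fin 3 →₀ ℕ, (∀ i, u i < q) → coeff u h = 0 := by
  have key : powIdeal k q = Ideal.span ((fun s => (monomial s) (1 : k)) ''
      (Set.range fun i : Fin 3 => Finsupp.single i q)) := by
    rw [powIdeal, ← Set.range_comp]
    congr 2
    funext i
    simp [X_pow_eq_monomial]
  rw [key, mem_ideal_span_monomial_image]
  constructor
  · intro H u hu
    by_contra hne
    obtain ⟨_, ⟨i, rfl⟩, hi⟩ := H u (mem_support_iff.mpr hne)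
    have := hi i
    simp only [Finsupp.single_eq_same] at this
    exact absurd (hu i) (not_lt.mpr this)
  · intro H u hu
    have : ¬ ∀ i, u i < q := fun h' => mem_support_iff.mp hu (H u h')
    push Not at this
    obtain ⟨i, hi⟩ := this
    refine ⟨_, ⟨i, rfl⟩, ?_⟩
    intro j
    by_cases hj : j = i
    · subst hj; simpa using hi
    · simp [Finsupp.single_eq_of_ne hj]

theorem mem_sup_powIdeal {q : ℕ} {f h : MvPolynomial (Fin 3) k} :
    h ∈ Ideal.span {f} ⊔ powIdeal k q ↔
      ∃ g, ∀ u : Fin 3 →₀ ℕ, (∀ i, u i < q) → coeff u h = coeff u (f * g) := by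
  rw [Submodule.mem_sup]
  constructor
  · rintro ⟨y, hy, z, hz, rfl⟩
    obtain ⟨g, rfl⟩ := Ideal.mem_span_singleton.mp hy
    refine ⟨g, fun u hu => ?_⟩
    rw [coeff_add, mem_powIdeal_iff.mp hz u hu, add_zero]
  · rintro ⟨g, hg⟩
    refine ⟨f * g, Ideal.mem_span_singleton.mpr ⟨g, rfl⟩, h - f * g, ?_, by ring⟩
    rw [mem_powIdeal_iff]
    intro u hu
    rw [coeff_sub, hg u hu, sub_self]

/-- The coefficient of `f * g` at `u` only depends on the coefficients of `g` at divisors of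
complementary degree. -/
theorem coeff_mul_congr {d : ℕ} {f g g' : MvPolynomial (Fin 3) k} (hf : f.IsHomogeneous d)
    {u : Fin 3 →₀ ℕ}
    (h : ∀ w ≤ u, w.degree + d = u.degree → coeff w g = coeff w g') :
    coeff u (f * g) = coeff u (f * g') := by
  rw [coeff_mul, coeff_mul]
  refine Finset.sum_congr rfl ?_
  rintro ⟨t, w⟩ htw
  rw [Finset.HasAntidiagonal.mem_antidiagonal] at htw
  simp only at htw ⊢
  by_cases ht : t.degree = d
  · rw [h w (htw ▸ le_add_self) (by rw [← htw, map_add, ht, add_comm])]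
  · rw [hf.coeff_eq_zero ht, zero_mul, zero_mul]

/-- The polynomial with prescribed coefficients on a finite set of exponents. -/
noncomputable def ofCoeffs (k : Type*) [Field k] (B : Finset (Fin 3 →₀ ℕ)) :
    (B → k) →ₗ[k] MvPolynomial (Fin 3) k :=
  Fintype.linearCombination k fun u : B => monomial (u : Fin 3 →₀ ℕ) (1 : k)

/-- The coefficients of a polynomial on a finite set of exponents. -/
noncomputable def toCoeffs (k : Type*) [Field k] (B : Finset (Fin 3 →₀ ℕ)) :
    MvPolynomial (Fin 3) k →ₗ[k] (B → k) :=
  LinearMap.pi fun u => lcoeff k (u : Fin 3 →₀ ℕ)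

@[simp] theorem toCoeffs_apply (B : Finset (Fin 3 →₀ ℕ)) (h : MvPolynomial (Fin 3) k) (u : B) :
    toCoeffs k B h u = coeff (u : Fin 3 →₀ ℕ) h := rfl

theorem coeff_ofCoeffs_mem (B : Finset (Fin 3 →₀ ℕ)) (c : B → k) (u : B) :
    coeff (u : Fin 3 →₀ ℕ) (ofCoeffs k B c) = c u := by
  classical
  simp [ofCoeffs, Fintype.linearCombination_apply, coeff_sum, coeff_smul, coeff_monomial]

theorem coeff_ofCoeffs_notMem (B : Finset (Fin 3 →₀ ℕ)) (c : B → k) {u : Fin 3 →₀ ℕ}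
    (hu : u ∉ B) : coeff u (ofCoeffs k B c) = 0 := by
  classical
  simp only [ofCoeffs, Fintype.linearCombination_apply, coeff_sum, coeff_smul, coeff_monomial]
  refine Finset.sum_eq_zero fun v _ => ?_
  rw [if_neg, smul_zero]
  rintro rfl
  exact hu v.2

theorem coeff_ofCoeffs_toCoeffs (B : Finset (Fin 3 →₀ ℕ)) (h : MvPolynomial (Fin 3) k)
    {u : Fin 3 →₀ ℕ} (hu : u ∈ B) : coeff u (ofCoeffs k B (toCoeffs k B h)) = coeff u h :=
  coeff_ofCoeffs_mem B _ ⟨u, hu⟩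

/-- Multiplication by a form of degree `d` from degrees below `m` to degrees below `m + d`,
modulo the `q`-th powers of the variables. -/
noncomputable def mulTrunc (q m d : ℕ) (f : MvPolynomial (Fin 3) k) :
    (boxBelow q m → k) →ₗ[k] (boxBelow q (m + d) → k) :=
  toCoeffs k _ ∘ₗ LinearMap.mulLeft k f ∘ₗ ofCoeffs k _

/-- The map sending coefficients in degrees below `m` to a class modulo
`(f, x ^ q, y ^ q, z ^ q)`. -/
noncomputable def classOf (q m : ℕ) (f : MvPolynomial (Fin 3) k) :
    (boxBelow q m → k) →ₗ[k] (MvPolynomial (Fin 3) k ⧸ (Ideal.span {f} ⊔ powIdeal k q)) :=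
  (Ideal.Quotient.mkₐ k _).toLinearMap ∘ₗ ofCoeffs k _

theorem mem_ker_classOf {q m : ℕ} {f : MvPolynomial (Fin 3) k} {c : boxBelow q m → k} :
    c ∈ LinearMap.ker (classOf q m f) ↔
      ofCoeffs k _ c ∈ Ideal.span {f} ⊔ powIdeal k q := by
  rw [LinearMap.mem_ker]
  exact Ideal.Quotient.eq_zero_iff_mem

theorem range_mulTrunc {q m d : ℕ} {f : MvPolynomial (Fin 3) k} (hf : f.IsHomogeneous d) :
    LinearMap.range (mulTrunc q m d f) = LinearMap.ker (classOf q (m + d) f) := by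
  ext c
  rw [mem_ker_classOf, mem_sup_powIdeal]
  constructor
  · rintro ⟨b, rfl⟩
    refine ⟨ofCoeffs k _ b, fun u hu => ?_⟩
    by_cases hm : u.degree < m + d
    · exact coeff_ofCoeffs_toCoeffs _ _ (mem_boxBelow.mpr ⟨hu, hm⟩)
    · rw [coeff_ofCoeffs_notMem _ _ fun h => hm (mem_boxBelow.mp h).2]
      rw [coeff_mul_congr (g' := 0) hf, mul_zero, coeff_zero]
      intro w _ hw
      rw [coeff_ofCoeffs_notMem _ _ fun h => hm ?_, coeff_zero]
      have := (mem_boxBelow.mp h).2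
      omega
  · rintro ⟨g, hg⟩
    refine ⟨toCoeffs k _ g, ?_⟩
    ext ⟨u, hu⟩
    have hu' := mem_boxBelow.mp hu
    rw [← coeff_ofCoeffs_mem _ c ⟨u, hu⟩, hg u hu'.1]
    refine coeff_mul_congr hf fun w hw hwd => coeff_ofCoeffs_toCoeffs _ _ (mem_boxBelow.mpr ⟨?_, ?_⟩)
    · exact fun i => (hw i).trans_lt (hu'.1 i)
    · have : u.degree < m + d := hu'.2
      have : w.degree + d = u.degree := hwd
      omega

theorem card_le_finrank_range_add {q m d : ℕ} {f : MvPolynomial (Fin 3) k}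
    (hf : f.IsHomogeneous d) :
    (boxBelow q (m + d)).card ≤
      Module.finrank k (LinearMap.range (classOf q (m + d) f)) + (boxBelow q m).card := by
  have h1 := LinearMap.finrank_range_add_finrank_ker (classOf q (m + d) f)
  have h2 := LinearMap.finrank_range_le (mulTrunc q m d f)
  rw [range_mulTrunc hf] at h2
  simp only [Module.finrank_fintype_fun_eq_card, Fintype.card_coe] at h1 h2
  omega

theorem finrank_range_add_le {q m d : ℕ} {f : MvPolynomial (Fin 3) k}
    (hf : f.IsHomogeneous d)
    (hinj : ∀ g, f * g ∈ powIdeal k q → ∀ u ∈ boxBelow q m, coeff u g = 0) :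
    Module.finrank k (LinearMap.range (classOf q (m + d) f)) + (boxBelow q m).card ≤
      (boxBelow q (m + d)).card := by
  have h1 := LinearMap.finrank_range_add_finrank_ker (classOf q (m + d) f)
  have h2 : Function.Injective (mulTrunc q m d f) := by
    rw [← LinearMap.ker_eq_bot, LinearMap.ker_eq_bot']
    intro c hc
    have hmem : f * ofCoeffs k _ c ∈ powIdeal k q := by
      rw [mem_powIdeal_iff]
      intro u hu
      by_cases hm : u.degree < m + d
      · exact congrFun hc ⟨u, mem_boxBelow.mpr ⟨hu, hm⟩⟩
      · rw [coeff_mul_congr (g' := 0) hf, mul_zero, coeff_zero]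
        intro w _ hw
        rw [coeff_ofCoeffs_notMem _ _ fun h => hm ?_, coeff_zero]
        have := (mem_boxBelow.mp h).2
        omega
    ext u
    rw [← coeff_ofCoeffs_mem _ c u]
    exact hinj _ hmem u u.2
  have h3 := LinearMap.finrank_range_of_inj h2
  rw [range_mulTrunc hf] at h3
  simp only [Module.finrank_fintype_fun_eq_card, Fintype.card_coe] at h1 h3
  omega

/-- Duality on the Artinian complete intersection `k[x,y,z]/(x ^ q, y ^ q, z ^ q)`: injectivity
of multiplication by `f` in low degrees gives surjectivity in high degrees. -/
theorem monomial_mem_of_le_degree {q m : ℕ} {f : MvPolynomial (Fin 3) k}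
    (hinj : ∀ g, f * g ∈ powIdeal k q → ∀ u ∈ boxBelow q m, coeff u g = 0)
    {v : Fin 3 →₀ ℕ} (hv : 3 * q ≤ v.degree + m) :
    monomial v (1 : k) ∈ Ideal.span {f} ⊔ powIdeal k q := by
  classical
  by_contra hnot
  have hvq : ∀ i, v i < q := by
    by_contra hcon
    refine hnot (Ideal.mem_sup_right (mem_powIdeal_iff.mpr fun u hu => ?_))
    rw [coeff_monomial, if_neg]
    rintro rfl
    exact hcon hu
  obtain ⟨ℓ, hℓv, hℓ⟩ := Submodule.exists_le_ker_of_notMem (K := k)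
    (p := (Ideal.span {f} ⊔ powIdeal k q).restrictScalars k) hnot
  have hℓ0 : ∀ h ∈ Ideal.span {f} ⊔ powIdeal k q, ℓ h = 0 := fun h hh => hℓ hh
  have hout : ∀ u : Fin 3 →₀ ℕ, (¬ ∀ i, u i < q) → ℓ (monomial u 1) = 0 := by
    intro u hu
    refine hℓ0 _ (Ideal.mem_sup_right (mem_powIdeal_iff.mpr fun w hw => ?_))
    rw [coeff_monomial, if_neg]
    rintro rfl
    exact hu hw
  set s : Fin 3 →₀ ℕ := Finsupp.equivFunOnFinite.symm fun _ => q - 1 with hs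
  have hsi : ∀ i, s i = q - 1 := fun i => rfl
  set B := boxBelow q (3 * q) with hB
  have hmemB : ∀ u : Fin 3 →₀ ℕ, (∀ i, u i < q) → u ∈ B := by
    intro u hu
    refine mem_boxBelow.mpr ⟨hu, ?_⟩
    rw [Finsupp.degree_eq_sum, Fin.sum_univ_three]
    have := hu 0; have := hu 1; have := hu 2
    omega
  set g := ofCoeffs k B fun u => ℓ (monomial (s - (u : Fin 3 →₀ ℕ)) 1) with hg
  have hgc : ∀ u : Fin 3 →₀ ℕ, (∀ i, u i < q) → coeff u g = ℓ (monomial (s - u) 1) :=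
    fun u hu => coeff_ofCoeffs_mem B _ ⟨u, hmemB u hu⟩
  have hfg : f * g ∈ powIdeal k q := by
    rw [mem_powIdeal_iff]
    intro w hw
    have h1 : ℓ (f * monomial (s - w) 1) = 0 :=
      hℓ0 _ (Ideal.mem_sup_left (Ideal.mem_span_singleton.mpr ⟨_, rfl⟩))
    rw [← h1]
    conv_rhs => rw [f.as_sum]
    rw [Finset.sum_mul, map_sum, coeff_mul]
    have h2 : ∀ t, ℓ (monomial t (coeff t f) * monomial (s - w) 1)
        = coeff t f * ℓ (monomial (t + (s - w)) 1) := by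
      intro t
      rw [monomial_mul, mul_one, ← smul_eq_mul, ← map_smul, smul_monomial, smul_eq_mul, mul_one]
    simp only [h2]
    have h3 : ∀ x ∈ Finset.HasAntidiagonal.antidiagonal w, coeff x.1 f * coeff x.2 g
        = coeff x.1 f * ℓ (monomial (x.1 + (s - w)) 1) := by
      rintro ⟨t, r⟩ htr
      rw [Finset.HasAntidiagonal.mem_antidiagonal] at htr
      simp only at htr ⊢
      have htr' : ∀ i, t i + r i = w i := fun i => by rw [← htr]; rfl
      rw [hgc r fun i => by have := htr' i; have := hw i; omega]
      have he : s - r = t + (s - w) := by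
        ext i
        have := htr' i; have := hw i; have := hsi i
        simp only [Finsupp.coe_tsub, Finsupp.coe_add, Pi.sub_apply, Pi.add_apply]
        omega
      rw [he]
    rw [Finset.sum_congr rfl h3]
    rw [← Finset.sum_image (f := fun t => coeff t f * ℓ (monomial (t + (s - w)) 1))
      (g := Prod.fst)]
    · refine Finset.sum_congr_of_eq_on_inter ?_ ?_ fun _ _ _ => rfl
      · intro t _ ht
        rw [notMem_support_iff.mp ht, zero_mul]
      · intro t _ ht
        rw [hout, mul_zero]
        intro hbox
        apply ht
        have hle : t ≤ w := by
          intro i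
          have h4 := hbox i; have := hw i; have := hsi i
          simp only [Finsupp.coe_tsub, Finsupp.coe_add, Pi.sub_apply, Pi.add_apply] at h4
          omega
        exact Finset.mem_image.mpr ⟨(t, w - t), by
          rw [Finset.HasAntidiagonal.mem_antidiagonal]; exact add_tsub_cancel_of_le hle, rfl⟩
    · rintro ⟨t, r⟩ h ⟨t', r'⟩ h' heq
      simp only [Finset.mem_coe,
        Finset.HasAntidiagonal.mem_antidiagonal] at h h' heq
      subst heq
      rw [← h'] at h
      rw [add_left_cancel h]
  have hsv : ∀ i, (s - v) i = q - 1 - v i := fun i => by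
    rw [Finsupp.coe_tsub, Pi.sub_apply, hsi]
  have hsvq : ∀ i, (s - v) i < q := fun i => by have := hsv i; have := hvq i; omega
  have h5 := hinj g hfg (s - v) (mem_boxBelow.mpr ⟨hsvq, by
    rw [Finsupp.degree_eq_sum, Fin.sum_univ_three] at hv ⊢
    rw [hsv, hsv, hsv]
    have := hvq 0; have := hvq 1; have := hvq 2
    omega⟩)
  rw [hgc _ hsvq] at h5
  have he : s - (s - v) = v := by
    ext i
    have := hsi i; have := hvq i
    simp only [Finsupp.coe_tsub, Pi.sub_apply]
    omega
  rw [he] at h5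
  exact hℓv h5

/-- Modulo a form of degree `d` containing `x ^ d`, every monomial is a combination of monomials
of the same degree with `x`-exponent less than `d`. -/
theorem monomial_mem_span_of_eval {q d : ℕ} {f : MvPolynomial (Fin 3) k}
    (hf : f.IsHomogeneous d) (hf1 : coeff (Finsupp.single 0 d) f = 1) (v : Fin 3 →₀ ℕ) :
    Ideal.Quotient.mk (Ideal.span {f} ⊔ powIdeal k q) (monomial v 1) ∈ Submodule.span k
      ((fun u => Ideal.Quotient.mk (Ideal.span {f} ⊔ powIdeal k q) (monomial u 1)) ''
        {u : Fin 3 →₀ ℕ | u 0 < d ∧ u.degree = v.degree}) := by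
  classical
  induction hn : v 0 using Nat.strong_induction_on generalizing v with
  | _ n ih =>
  by_cases hvd : v 0 < d
  · exact Submodule.subset_span ⟨v, ⟨hvd, rfl⟩, rfl⟩
  push Not at hvd
  set w := v - Finsupp.single 0 d with hw
  have hwv : Finsupp.single 0 d + w = v := add_tsub_cancel_of_le (by
    simpa [Finsupp.single_le_iff] using hvd)
  have hsplit : f * monomial w 1 = monomial v 1 +
      ∑ t ∈ f.support.erase (Finsupp.single 0 d), coeff t f • monomial (t + w) (1 : k) := by
    conv_lhs => rw [f.as_sum]
    rw [← Finset.add_sum_erase _ _ (show Finsupp.single 0 d ∈ f.support by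
      rw [mem_support_iff, hf1]; exact one_ne_zero), add_mul, hf1, monomial_mul, hwv, mul_one,
      Finset.sum_mul]
    congr 1
    refine Finset.sum_congr rfl fun t _ => ?_
    rw [monomial_mul, smul_monomial, smul_eq_mul]
  have h0 : Ideal.Quotient.mk (Ideal.span {f} ⊔ powIdeal k q) (f * monomial w 1) = 0 :=
    Ideal.Quotient.eq_zero_iff_mem.mpr
      (Ideal.mem_sup_left (Ideal.mem_span_singleton.mpr ⟨_, rfl⟩))
  rw [hsplit, map_add, map_sum] at h0
  rw [eq_neg_of_add_eq_zero_left h0]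
  refine Submodule.neg_mem _ (Submodule.sum_mem _ fun t ht => ?_)
  have htd : t.degree = d := by
    by_contra hne
    exact mem_support_iff.mp (Finset.mem_of_mem_erase ht) (hf.coeff_eq_zero hne)
  have ht0 : t 0 < d := by
    rcases lt_or_ge (t 0) d with h | h
    · exact h
    · exfalso
      apply Finset.ne_of_mem_erase ht
      rw [Finsupp.degree_eq_sum, Fin.sum_univ_three] at htd
      ext i
      fin_cases i <;> simp <;> omega
  have hdeg : (t + w).degree = v.degree := by
    rw [map_add, ← hwv, map_add, htd, Finsupp.degree_single]
  have hlt : (t + w) 0 < n := by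
    have h1 := DFunLike.congr_fun hwv 0
    simp only [Finsupp.coe_add, Pi.add_apply, Finsupp.single_eq_same] at h1 ⊢
    omega
  have := ih _ hlt (t + w) rfl
  rw [hdeg] at this
  exact Submodule.smul_mem _ _ this

end Count

section Bounds

variable {k : Type*} [Field k]

/-- Exponent vectors with first entry less than `d` and degree in the window
`[m + d, 3 * q - m)`. -/
noncomputable def window (q m d : ℕ) : Finset (Fin 3 →₀ ℕ) :=
  (Finset.range d ×ˢ Finset.range (3 * q) ×ˢ Finset.Ico (m + d) (3 * q - m)).image fun x =>
    Finsupp.equivFunOnFinite.symm ![x.1, x.2.1, x.2.2 - x.1 - x.2.1]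

theorem card_window_le (q m d : ℕ) :
    (window q m d).card ≤ d * (3 * q * (3 * q - m - (m + d))) := by
  refine Finset.card_image_le.trans ?_
  simp

theorem mem_window {q m d : ℕ} {u : Fin 3 →₀ ℕ} (h0 : u 0 < d) (h1 : m + d ≤ u.degree)
    (h2 : u.degree + m < 3 * q) : u ∈ window q m d := by
  rw [Finsupp.degree_eq_sum, Fin.sum_univ_three] at h1 h2
  refine Finset.mem_image.mpr ⟨(u 0, u 1, u 0 + u 1 + u 2), ?_, ?_⟩
  · simp only [Finset.mem_product, Finset.mem_range, Finset.mem_Ico]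
    omega
  · ext i
    fin_cases i
    · rfl
    · rfl
    · change u 0 + u 1 + u 2 - u 0 - u 1 = u 2
      omega

theorem range_classOf_sup_span_window {q m d : ℕ} {f : MvPolynomial (Fin 3) k}
    (hf : f.IsHomogeneous d) (hf1 : coeff (Finsupp.single 0 d) f = 1)
    (hinj : ∀ g, f * g ∈ powIdeal k q → ∀ u ∈ boxBelow q m, coeff u g = 0) :
    LinearMap.range (classOf q (m + d) f) ⊔ Submodule.span k
      ((fun u => Ideal.Quotient.mk (Ideal.span {f} ⊔ powIdeal k q) (monomial u 1)) ''
        (window q m d : Set (Fin 3 →₀ ℕ))) = ⊤ := by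
  classical
  rw [eq_top_iff]
  rintro x -
  obtain ⟨h, rfl⟩ := Ideal.Quotient.mk_surjective x
  rw [h.as_sum, map_sum]
  refine Submodule.sum_mem _ fun v _ => ?_
  have hs : Ideal.Quotient.mk (Ideal.span {f} ⊔ powIdeal k q) (monomial v (coeff v h)) =
      coeff v h • Ideal.Quotient.mk (Ideal.span {f} ⊔ powIdeal k q) (monomial v 1) := by
    rw [← mul_one (coeff v h), ← smul_eq_mul, ← smul_monomial]
    simp only [smul_eq_mul, mul_one]
    rfl
  rw [hs]
  refine Submodule.smul_mem _ _ ?_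
  rcases lt_or_ge v.degree (m + d) with h1 | h1
  · refine Submodule.mem_sup_left ⟨toCoeffs k _ (monomial v 1), ?_⟩
    refine Ideal.Quotient.eq.mpr (Ideal.mem_sup_right (mem_powIdeal_iff.mpr fun u hu => ?_))
    rw [coeff_sub, sub_eq_zero]
    by_cases hm : u.degree < m + d
    · exact coeff_ofCoeffs_toCoeffs _ _ (mem_boxBelow.mpr ⟨hu, hm⟩)
    · rw [coeff_ofCoeffs_notMem _ _ fun h => hm (mem_boxBelow.mp h).2, coeff_monomial, if_neg]
      rintro rfl
      exact hm h1
  rcases lt_or_ge (v.degree + m) (3 * q) with h2 | h2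
  · refine Submodule.mem_sup_right
      (Submodule.span_mono ?_ (monomial_mem_span_of_eval (q := q) hf hf1 v))
    rintro _ ⟨u, ⟨hu0, hud⟩, rfl⟩
    exact ⟨u, mem_window hu0 (hud ▸ h1) (hud ▸ h2), rfl⟩
  · rw [Ideal.Quotient.eq_zero_iff_mem.mpr (monomial_mem_of_le_degree hinj h2)]
    exact Submodule.zero_mem _

theorem finrank_quotient_bounds {q m d : ℕ} {f : MvPolynomial (Fin 3) k}
    (hf : f.IsHomogeneous d) (hf1 : coeff (Finsupp.single 0 d) f = 1)
    (hinj : ∀ g, f * g ∈ powIdeal k q → ∀ u ∈ boxBelow q m, coeff u g = 0) :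
    (boxBelow q (m + d)).card ≤
        Module.finrank k (MvPolynomial (Fin 3) k ⧸ (Ideal.span {f} ⊔ powIdeal k q)) +
          (boxBelow q m).card ∧
      Module.finrank k (MvPolynomial (Fin 3) k ⧸ (Ideal.span {f} ⊔ powIdeal k q)) +
          (boxBelow q m).card ≤
        (boxBelow q (m + d)).card + d * (3 * q * (3 * q - m - (m + d))) := by
  classical
  have htop := range_classOf_sup_span_window hf hf1 hinj
  rw [← Finset.coe_image] at htop
  set U := Submodule.span k (((window q m d).image fun u =>
    Ideal.Quotient.mk (Ideal.span {f} ⊔ powIdeal k q) (monomial u 1) : Finset _) :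
      Set (MvPolynomial (Fin 3) k ⧸ (Ideal.span {f} ⊔ powIdeal k q))) with hU
  have : FiniteDimensional k U := FiniteDimensional.span_finset k _
  have hfin : FiniteDimensional k
      (MvPolynomial (Fin 3) k ⧸ (Ideal.span {f} ⊔ powIdeal k q)) := by
    have : FiniteDimensional k (⊤ : Submodule k
        (MvPolynomial (Fin 3) k ⧸ (Ideal.span {f} ⊔ powIdeal k q))) := by
      rw [← htop]; infer_instance
    exact Module.finite_def.mpr (Submodule.fg_top _ |>.mp (Module.finite_def.mp this))
  have h1 := card_le_finrank_range_add (q := q) (m := m) hf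
  have h2 := finrank_range_add_le hf hinj
  have h3 := Submodule.finrank_le (LinearMap.range (classOf q (m + d) f))
  have h4 := Submodule.finrank_add_le_finrank_add_finrank
    (LinearMap.range (classOf q (m + d) f)) U
  rw [htop, finrank_top] at h4
  have h5 : Module.finrank k U ≤ (window q m d).card :=
    (finrank_span_finset_le_card _).trans Finset.card_image_le
  have h6 := card_window_le q m d
  omega

/-- The number of exponent vectors of degree `q - 1 + s` with all entries less than `q`. -/
theorem two_mul_card_slice {q s : ℕ} (hs : s < q) :
    2 * (((boxBelow q (q - 1 + s + 1)).card : ℤ) - (boxBelow q (q - 1 + s)).card) =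
      2 * q ^ 2 - (s * (s + 1) + (q - 1 - s) * (q - s)) := by
  classical
  have hsub : boxBelow q (q - 1 + s) ⊆ boxBelow q (q - 1 + s + 1) := by
    intro u hu
    rw [mem_boxBelow] at hu ⊢
    exact ⟨hu.1, by omega⟩
  have hcard : ((boxBelow q (q - 1 + s + 1)) \ (boxBelow q (q - 1 + s))).card =
      ((Finset.range q).sigma fun a => Finset.Ico (s - a) (q - (a - s))).card := by
    refine Finset.card_bij' (fun u _ => ⟨u 0, u 1⟩)
      (fun x _ => Finsupp.equivFunOnFinite.symm ![x.1, x.2, q - 1 + s - x.1 - x.2]) ?_ ?_ ?_ ?_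
    · intro u hu
      rw [Finset.mem_sdiff, mem_boxBelow, mem_boxBelow] at hu
      obtain ⟨⟨h1, h2⟩, h3⟩ := hu
      have h4 : ¬ u.degree < q - 1 + s := fun h => h3 ⟨h1, h⟩
      rw [Finsupp.degree_eq_sum, Fin.sum_univ_three] at h2 h4
      have := h1 0; have := h1 1; have := h1 2
      simp only [Finset.mem_sigma, Finset.mem_range, Finset.mem_Ico]
      omega
    · rintro ⟨a, b⟩ hx
      simp only [Finset.mem_sigma, Finset.mem_range, Finset.mem_Ico] at hx
      rw [Finset.mem_sdiff, mem_boxBelow, mem_boxBelow, Finsupp.degree_eq_sum, Fin.sum_univ_three]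
      simp only [Fin.forall_fin_succ, Finsupp.equivFunOnFinite_symm_apply_apply]
      simp
      omega
    · intro u hu
      rw [Finset.mem_sdiff, mem_boxBelow, mem_boxBelow] at hu
      obtain ⟨⟨h1, h2⟩, h3⟩ := hu
      have h4 : ¬ u.degree < q - 1 + s := fun h => h3 ⟨h1, h⟩
      rw [Finsupp.degree_eq_sum, Fin.sum_univ_three] at h2 h4
      ext i
      fin_cases i
      · rfl
      · rfl
      · change q - 1 + s - u 0 - u 1 = u 2
        omega
    · rintro ⟨a, b⟩ hx
      rfl
  have h1 := Finset.card_sdiff_add_card_eq_card hsub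
  rw [hcard, Finset.card_sigma] at h1
  have h3 : (∑ a ∈ Finset.range q, (Finset.Ico (s - a) (q - (a - s))).card : ℕ) =
      ∑ a ∈ Finset.range q, (q - (s - a) - (a - s)) := by
    refine Finset.sum_congr rfl fun a _ => ?_
    rw [Nat.card_Ico]
    omega
  have h4 : ∀ n, n ≤ q → (2 * ((∑ a ∈ Finset.range n, (q - (s - a) - (a - s)) : ℕ) : ℤ)) =
      if n ≤ s then 2 * (n : ℤ) * q - (s * (s + 1) - (s - n) * (s - n + 1))
      else 2 * (n : ℤ) * q - (s * (s + 1) + (n - 1 - s) * (n - s)) := by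
    intro n hn
    induction n with
    | zero => simp
    | succ n ih =>
      rw [Finset.sum_range_succ, Nat.cast_add, mul_add, ih (by omega)]
      rcases lt_trichotomy n s with h | h | h
      · have e : ((q - (s - n) - (n - s) : ℕ) : ℤ) = q - (s - n) := by omega
        rw [if_pos (by omega), if_pos (by omega), e]
        push_cast
        ring
      · subst h
        rw [if_pos le_rfl, if_neg (by omega)]
        simp
        ring
      · have e : ((q - (s - n) - (n - s) : ℕ) : ℤ) = q - (n - s) := by omega
        rw [if_neg (by omega), if_neg (by omega), e]
        push_cast
        ring
  have h5 := h4 q le_rfl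
  rw [if_neg (by omega)] at h5
  rw [← h1, h3]
  push_cast at h5 ⊢
  linarith

end Bounds

section Limit

variable {k : Type*} [Field k]

theorem coeff_eq_zero_of_homogeneous_injective {q d m : ℕ} {f : MvPolynomial (Fin 3) k}
    (hf : f.IsHomogeneous d)
    (hinj : ∀ i < m, ∀ g : MvPolynomial (Fin 3) k, g.IsHomogeneous i →
      f * g ∈ powIdeal k q → g ∈ powIdeal k q) :
    ∀ g, f * g ∈ powIdeal k q → ∀ u ∈ boxBelow q m, coeff u g = 0 := by
  intro g hg u hu
  rw [mem_boxBelow] at hu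
  have h1 := hinj u.degree hu.2 (homogeneousComponent u.degree g)
    (homogeneousComponent_isHomogeneous _ _) ?_
  · have h2 := mem_powIdeal_iff.mp h1 u hu.1
    rwa [coeff_homogeneousComponent, if_pos rfl] at h2
  · rw [mem_powIdeal_iff] at hg ⊢
    intro w hw
    by_cases hd : w.degree = d + u.degree
    · rw [← hg w hw]
      refine coeff_mul_congr hf fun v _ hv => ?_
      rw [coeff_homogeneousComponent, if_pos (by omega)]
    · exact (hf.mul (homogeneousComponent_isHomogeneous _ _)).coeff_eq_zero hd

theorem abs_four_mul_card_sub_le {q m T : ℕ} (d : ℕ) (hq : T < q)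
    (h1 : 3 * q ≤ 2 * m + T) (h2 : 2 * m + 2 * d + 2 ≤ 3 * q + T) :
    |4 * (((boxBelow q (m + d)).card : ℤ) - (boxBelow q m).card) - 3 * d * q ^ 2| ≤
      (d * (T ^ 2 + 2 * T) : ℤ) := by
  induction d with
  | zero => simp
  | succ d ih =>
    have ih := ih (by omega)
    obtain ⟨s, hs⟩ : ∃ s, m + d = q - 1 + s := ⟨m + d + 1 - q, by omega⟩
    have h3 := two_mul_card_slice (q := q) (s := s) (by omega)
    rw [← hs] at h3
    have h4 : |(2 * s - q : ℤ)| ≤ T := abs_le.mpr ⟨by omega, by omega⟩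
    have h5 : |4 * (((boxBelow q (m + d + 1)).card : ℤ) - (boxBelow q (m + d)).card) - 3 * q ^ 2| ≤
        (T ^ 2 + 2 * T : ℤ) := by
      have h6 : 4 * (((boxBelow q (m + d + 1)).card : ℤ) - (boxBelow q (m + d)).card) - 3 * q ^ 2 =
          -((2 * s - q : ℤ) ^ 2 + 2 * (2 * s - q)) := by linear_combination 2 * h3
      rw [h6, abs_neg]
      refine (abs_add_le _ _).trans ?_
      rw [abs_pow, abs_mul, abs_two]
      gcongr
    have h7 := abs_add_le
      (4 * (((boxBelow q (m + d)).card : ℤ) - (boxBelow q m).card) - 3 * d * q ^ 2)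
      (4 * (((boxBelow q (m + d + 1)).card : ℤ) - (boxBelow q (m + d)).card) - 3 * q ^ 2)
    rw [← add_assoc]
    push_cast
    calc _ = _ := by congr 1; ring
      _ ≤ _ := h7
      _ ≤ _ := by linarith

theorem exists_abs_finrank_sub_le (c d : ℕ) :
    ∃ C : ℕ, ∀ (q : ℕ) (f : MvPolynomial (Fin 3) k), C < q → f.IsHomogeneous d →
      coeff (Finsupp.single 0 d) f = 1 →
      (∀ (i : ℕ) (g : MvPolynomial (Fin 3) k), 2 * i + c < 3 * q → g.IsHomogeneous i →
        f * g ∈ powIdeal k q → g ∈ powIdeal k q) →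
      |4 * (Module.finrank k (MvPolynomial (Fin 3) k ⧸ (Ideal.span {f} ⊔ powIdeal k q)) : ℝ) -
        3 * d * (q : ℝ) ^ 2| ≤ (C * q : ℝ) := by
  set T := c + 2 * d + 2 with hT
  refine ⟨d * (T ^ 2 + 2 * T) + 12 * d * (c + 1) + T, fun q f hq hf hf1 hinj => ?_⟩
  have hqT : T < q := by omega
  set m := (3 * q - c) / 2 with hm
  have hb := finrank_quotient_bounds hf hf1 (coeff_eq_zero_of_homogeneous_injective (m := m) hf
    fun i hi g => hinj i g (by omega))
  set D := Module.finrank k (MvPolynomial (Fin 3) k ⧸ (Ideal.span {f} ⊔ powIdeal k q)) with hD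
  have h1 := abs_four_mul_card_sub_le (q := q) (m := m) (T := T) d hqT (by omega) (by omega)
  have h2 : d * (3 * q * (3 * q - m - (m + d))) ≤ d * (3 * q * (c + 1)) := by
    gcongr
    omega
  have h3 := hb.2.trans (Nat.add_le_add_left h2 _)
  have h4 := hb.1
  suffices h : |4 * (D : ℤ) - 3 * d * (q : ℤ) ^ 2| ≤
      ((d * (T ^ 2 + 2 * T) + 12 * d * (c + 1) + T : ℕ) * q : ℤ) by
    exact_mod_cast h
  have hq1 : (d * (T ^ 2 + 2 * T) : ℤ) ≤ d * (T ^ 2 + 2 * T) * q := by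
    refine le_mul_of_one_le_right (by positivity) ?_
    omega
  have hq2 : (0 : ℤ) ≤ T * q := by positivity
  have hq3 : (0 : ℤ) ≤ 12 * d * (c + 1) * q := by positivity
  rw [abs_le] at h1 ⊢
  zify at h3 h4
  push_cast
  constructor <;> nlinarith [h1.1, h1.2]

theorem tendsto_of_homogeneous_injective {p : ℕ} (hp : 1 < p) {c d : ℕ}
    {f : MvPolynomial (Fin 3) k} (hf : f.IsHomogeneous d)
    (hf1 : coeff (Finsupp.single 0 d) f = 1)
    (hinj : ∀ (n i : ℕ) (g : MvPolynomial (Fin 3) k), 2 * i + c < 3 * p ^ n →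
      g.IsHomogeneous i → f * g ∈ powIdeal k (p ^ n) → g ∈ powIdeal k (p ^ n)) :
    Filter.Tendsto (fun n : ℕ => (Module.finrank k (MvPolynomial (Fin 3) k ⧸
        (Ideal.span {f} ⊔ powIdeal k (p ^ n))) : ℝ) / (p : ℝ) ^ (2 * n))
      Filter.atTop (nhds (3 * d / 4)) := by
  obtain ⟨C, hC⟩ := exists_abs_finrank_sub_le (k := k) c d
  have hpow : Filter.Tendsto (fun n : ℕ => p ^ n) Filter.atTop Filter.atTop :=
    tendsto_pow_atTop_atTop_of_one_lt hp
  rw [tendsto_iff_norm_sub_tendsto_zero]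
  have hlim : Filter.Tendsto (fun n : ℕ => (C : ℝ) / ((p ^ n : ℕ) : ℝ)) Filter.atTop (nhds 0) :=
    (tendsto_const_div_atTop_nhds_zero_nat (C : ℝ)).comp hpow
  refine squeeze_zero' (Filter.Eventually.of_forall fun _ => norm_nonneg _) ?_ hlim
  filter_upwards [hpow.eventually_gt_atTop C] with n hn
  have h := hC (p ^ n) f hn hf hf1 (hinj n)
  have hq : (0 : ℝ) < ((p ^ n : ℕ) : ℝ) := by
    have : 0 < p ^ n := by positivity
    exact_mod_cast this
  have he : (p : ℝ) ^ (2 * n) = ((p ^ n : ℕ) : ℝ) ^ 2 := by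
    push_cast
    rw [← pow_mul, mul_comm]
  rw [he, Real.norm_eq_abs]
  set q : ℝ := ((p ^ n : ℕ) : ℝ)
  set D : ℝ := (Module.finrank k (MvPolynomial (Fin 3) k ⧸
    (Ideal.span {f} ⊔ powIdeal k (p ^ n))) : ℝ)
  have h1 : D / q ^ 2 - 3 * d / 4 = (4 * D - 3 * d * q ^ 2) / (4 * q ^ 2) := by
    field_simp
  rw [h1, abs_div, abs_of_pos (by positivity : 0 < 4 * q ^ 2), div_le_div_iff₀ (by positivity) hq]
  have h2 : (0 : ℝ) ≤ C * q ^ 2 := by positivity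
  nlinarith [mul_le_mul_of_nonneg_right h hq.le]

end Limit

section Splitting

variable {k : Type*} [Field k]

theorem homogeneousComponent_mul_of_homogeneous {d D : ℕ} {f : MvPolynomial (Fin 3) k}
    (hf : f.IsHomogeneous d) (hd : d ≤ D) (s : MvPolynomial (Fin 3) k) :
    homogeneousComponent D (f * s) = f * homogeneousComponent (D - d) s := by
  ext v
  rw [coeff_homogeneousComponent]
  split_ifs with hv
  · refine coeff_mul_congr hf fun w _ hw => ?_
    rw [coeff_homogeneousComponent, if_pos (by omega)]
  · refine ((hf.mul (homogeneousComponent_isHomogeneous (D - d) s)).coeff_eq_zero ?_).symm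
    omega

theorem homogeneousComponent_mul_eq_zero {d D : ℕ} {f : MvPolynomial (Fin 3) k}
    (hf : f.IsHomogeneous d) (hd : D < d) (s : MvPolynomial (Fin 3) k) :
    homogeneousComponent D (f * s) = 0 := by
  ext v
  rw [coeff_homogeneousComponent]
  split_ifs with hv
  · rw [coeff_mul_congr (g' := 0) hf fun w _ hw => by omega, mul_zero]
  · simp

theorem dvd_homogeneousComponent {d : ℕ} {f : MvPolynomial (Fin 3) k}
    (hf : f.IsHomogeneous d) {h : MvPolynomial (Fin 3) k} (hfh : f ∣ h) (D : ℕ) :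
    f ∣ homogeneousComponent D h := by
  obtain ⟨s, rfl⟩ := hfh
  rcases le_or_gt d D with hd | hd
  · exact ⟨_, homogeneousComponent_mul_of_homogeneous hf hd s⟩
  · rw [homogeneousComponent_mul_eq_zero hf hd]
    exact dvd_zero f

theorem dvd_of_dvd_sub_mul {d D D' : ℕ} {f w h u : MvPolynomial (Fin 3) k}
    (hf : f.IsHomogeneous d) (hw : w.IsHomogeneous D) (hu : u.IsHomogeneous D') (hD : D < D')
    (hdvd : f ∣ w - u * h) : f ∣ w := by
  have := dvd_homogeneousComponent hf hdvd D
  rwa [map_sub, homogeneousComponent_mul_eq_zero hu hD, sub_zero,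
    homogeneousComponent_of_mem ((mem_homogeneousSubmodule _ _).mpr hw), if_pos rfl] at this

/-- `X 1, X 2` is a regular sequence modulo a polynomial which is monic in `X 0`. -/
theorem exists_dvd_sub_X_one_pow_mul {f : MvPolynomial (Fin 3) k}
    (hf : (finSuccEquiv k 2 f).Monic) (M : ℕ) {r r' : MvPolynomial (Fin 3) k}
    (h : f ∣ r * X 2 ^ M - r' * X 1 ^ M) : ∃ s, f ∣ r - X 1 ^ M * s := by
  set F := finSuccEquiv k 2 f with hF
  set R := finSuccEquiv k 2 r with hR
  set R' := finSuccEquiv k 2 r' with hR'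
  have h1 : finSuccEquiv k 2 (X 1) = Polynomial.C (X 0) := finSuccEquiv_X_succ (j := 0)
  have h2 : finSuccEquiv k 2 (X 2) = Polynomial.C (X 1) := finSuccEquiv_X_succ (j := 1)
  have hdvd : F ∣ R * Polynomial.C (X 1) ^ M - R' * Polynomial.C (X 0) ^ M := by
    have := map_dvd (finSuccEquiv k 2) h
    simpa [h1, h2] using this
  have heq : (X 1 ^ M : MvPolynomial (Fin 2) k) • (R %ₘ F)
      = (X 0 ^ M : MvPolynomial (Fin 2) k) • (R' %ₘ F) := by
    rw [← Polynomial.smul_modByMonic, ← Polynomial.smul_modByMonic, ← sub_eq_zero,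
      ← Polynomial.sub_modByMonic, Polynomial.modByMonic_eq_zero_iff_dvd hf]
    convert hdvd using 2
    · rw [Polynomial.smul_eq_C_mul, map_pow, mul_comm]
    · rw [Polynomial.smul_eq_C_mul, map_pow, mul_comm]
  have hc : Polynomial.C (X 0 ^ M : MvPolynomial (Fin 2) k) ∣ R %ₘ F := by
    rw [Polynomial.C_dvd_iff_dvd_coeff]
    intro j
    have hj := congrArg (fun P => Polynomial.coeff P j) heq
    simp only [Polynomial.coeff_smul, smul_eq_mul] at hj
    refine (X_prime (R := k) (i := (0 : Fin 2))).pow_dvd_of_dvd_mul_left M ?_ (Dvd.intro _ hj.symm)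
    intro hdvd
    have h10 : X (0 : Fin 2) ∣ (X 1 : MvPolynomial (Fin 2) k) := X_prime.dvd_of_dvd_pow hdvd
    rw [X_dvd_X] at h10
    exact absurd h10 (by simp)
  obtain ⟨T, hT⟩ := hc
  refine ⟨(finSuccEquiv k 2).symm T, ?_⟩
  rw [← map_dvd_iff (finSuccEquiv k 2)]
  simp only [map_sub, map_mul, map_pow, h1, AlgEquiv.apply_symm_apply]
  refine ⟨R /ₘ F, ?_⟩
  have := Polynomial.modByMonic_add_div R F
  rw [hT, map_pow] at this
  rw [← hR, ← hF]
  linear_combination -this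

end Splitting

section Cross

variable {A : Type*} [CommRing A]

theorem cross_parallel {C a b : Fin 3 → A} (hC : ∑ j, C j * crossProduct a b j = 0) (i j : Fin 3) :
    crossProduct C a i * crossProduct a b j = crossProduct C a j * crossProduct a b i := by
  simp only [cross_apply, Fin.sum_univ_three, Matrix.cons_val_zero, Matrix.cons_val_one,
    Matrix.cons_val] at hC
  fin_cases i <;> fin_cases j <;>
    simp only [cross_apply, Fin.zero_eta, Fin.mk_one, Fin.reduceFinMk, Matrix.cons_val_zero,
      Matrix.cons_val_one, Matrix.cons_val]
  · linear_combination a 2 * hC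
  · linear_combination -a 1 * hC
  · linear_combination -a 2 * hC
  · linear_combination a 0 * hC
  · linear_combination a 1 * hC
  · linear_combination -a 0 * hC

theorem eq_zero_of_cross_eq_zero [IsDomain A] {C a b : Fin 3 → A} (ha : crossProduct C a = 0)
    (hb : crossProduct C b = 0) (hab : crossProduct a b ≠ 0) : C = 0 := by
  by_contra hC
  obtain ⟨i, hi⟩ := Function.ne_iff.mp hC
  apply hab
  have key : ∀ a : Fin 3 → A, crossProduct C a = 0 → ∀ j l, C j * a l = C l * a j := by
    intro a h
    have h0 := congrFun h 0
    have h1 := congrFun h 1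
    have h2 := congrFun h 2
    simp only [cross_apply, Matrix.cons_val_zero, Matrix.cons_val_one, Matrix.cons_val,
      Pi.zero_apply] at h0 h1 h2
    intro j l
    fin_cases j <;> fin_cases l <;> simp only [Fin.zero_eta, Fin.mk_one, Fin.reduceFinMk] <;>
      first
        | rfl
        | linear_combination h0
        | linear_combination -h0
        | linear_combination h1
        | linear_combination -h1
        | linear_combination h2
        | linear_combination -h2
  have hz : ∀ j l, a j * b l - a l * b j = 0 := by
    intro j l
    refine (mul_eq_zero.mp ?_).resolve_left (pow_ne_zero 2 hi)
    have e1 := key a ha i j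
    have e2 := key a ha i l
    have e3 := key b hb i j
    have e4 := key b hb i l
    calc C i ^ 2 * (a j * b l - a l * b j)
        = (C i * a j) * (C i * b l) - (C i * a l) * (C i * b j) := by ring
      _ = 0 := by rw [e1, e2, e3, e4]; ring
  rw [cross_apply]
  ext l
  fin_cases l <;> simpa using hz _ _

theorem cross_pow_char (p n : ℕ) [Fact p.Prime] [CharP A p] (a b : Fin 3 → A) (j : Fin 3) :
    crossProduct (fun i => a i ^ p ^ n) (fun i => b i ^ p ^ n) j
      = crossProduct a b j ^ p ^ n := by
  fin_cases j <;> simp [cross_apply, sub_pow_char_pow, mul_pow]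

end Cross

section Splitting

variable {k : Type*} [Field k]

theorem isHomogeneous_cross {m n : ℕ} {a b : Fin 3 → MvPolynomial (Fin 3) k}
    (ha : ∀ i, (a i).IsHomogeneous m) (hb : ∀ i, (b i).IsHomogeneous n) (i : Fin 3) :
    (crossProduct a b i).IsHomogeneous (m + n) := by
  fin_cases i <;> simp only [cross_apply] <;> exact ((ha _).mul (hb _)).sub ((ha _).mul (hb _))

theorem exists_pow_eq_sum_pow {p : ℕ} [Fact p.Prime] [CharP k p] {N : ℕ} (n : ℕ)
    {f h : MvPolynomial (Fin 3) k} {G : Fin 3 → MvPolynomial (Fin 3) k}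
    (hh : h ^ N ∈ Ideal.span {f} ⊔ Ideal.span (Set.range G)) :
    ∃ α : Fin 3 → MvPolynomial (Fin 3) k, f ∣ h ^ (N * p ^ n) - ∑ i, α i * G i ^ p ^ n := by
  obtain ⟨y, hy, z, hz, hyz⟩ := Submodule.mem_sup.mp hh
  obtain ⟨s, rfl⟩ := Ideal.mem_span_singleton.mp hy
  obtain ⟨α, rfl⟩ := Ideal.mem_span_range_iff_exists_fun.mp hz
  refine ⟨fun i => α i ^ p ^ n, ?_⟩
  have : h ^ (N * p ^ n) - ∑ i, α i ^ p ^ n * G i ^ p ^ n = (f * s) ^ p ^ n := by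
    rw [pow_mul, ← hyz, add_pow_char_pow, sum_pow_char_pow]
    simp [mul_pow]
  rw [this]
  exact dvd_pow (dvd_mul_right f s) (pow_ne_zero _ (Fact.out : p.Prime).ne_zero)

theorem dvd_of_parallel {d D D' M : ℕ} {f : MvPolynomial (Fin 3) k} (hf : f.IsHomogeneous d)
    (hprime : Prime f) (hmonic : (finSuccEquiv k 2 f).Monic) (hX : ¬ f ∣ X 1)
    {w g α β : Fin 3 → MvPolynomial (Fin 3) k} (hw : ∀ i, (w i).IsHomogeneous D)
    (hg : ∀ i, (g i).IsHomogeneous D') (hD : D < D')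
    (hpar : ∀ i j, f ∣ w i * g j - w j * g i)
    (hα : f ∣ X 1 ^ M - ∑ i, α i * g i) (hβ : f ∣ X 2 ^ M - ∑ i, β i * g i) (j : Fin 3) :
    f ∣ w j := by
  have hIp : (Ideal.span {f}).IsPrime := (Ideal.span_singleton_prime hprime.ne_zero).mpr hprime
  set π := Ideal.Quotient.mk (Ideal.span {f}) with hπ
  have hz : ∀ s, π s = 0 ↔ f ∣ s := fun s => by
    rw [hπ, Ideal.Quotient.eq_zero_iff_mem, Ideal.mem_span_singleton]
  have hX1 : π (X 1) ≠ 0 := fun h => hX ((hz _).mp h)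
  simp only [← hz, map_sub, map_mul, map_pow, map_sum, sub_eq_zero] at hpar hα hβ
  have mulsum : ∀ (γ : Fin 3 → MvPolynomial (Fin 3) k) (i : Fin 3),
      π (∑ l, γ l * w l) * π (g i) = (∑ l, π (γ l) * π (g l)) * π (w i) := by
    intro γ i
    rw [map_sum, Finset.sum_mul, Finset.sum_mul]
    refine Finset.sum_congr rfl fun l _ => ?_
    rw [map_mul]
    linear_combination π (γ l) * hpar l i
  obtain ⟨i, hi⟩ : ∃ i, π (g i) ≠ 0 := by
    by_contra! hall
    apply pow_ne_zero M hX1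
    rw [hα]
    simp [hall]
  have hcross : f ∣ (∑ l, α l * w l) * X 2 ^ M - (∑ l, β l * w l) * X 1 ^ M := by
    rw [← hz, map_sub, map_mul, map_mul, map_pow, map_pow, sub_eq_zero]
    refine mul_right_cancel₀ hi ?_
    rw [hα, hβ]
    linear_combination (∑ l, π (β l) * π (g l)) * mulsum α i
      - (∑ l, π (α l) * π (g l)) * mulsum β i
  obtain ⟨s, hs⟩ := exists_dvd_sub_X_one_pow_mul hmonic M hcross
  refine dvd_of_dvd_sub_mul (h := s) hf (hw j) (hg j) hD ?_
  rw [← hz, map_sub, map_mul, map_pow, sub_eq_zero] at hs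
  rw [← hz, map_sub, map_mul, sub_eq_zero]
  refine mul_left_cancel₀ (pow_ne_zero M hX1) ?_
  have := mulsum α j
  rw [hs, ← hα] at this
  linear_combination -this

theorem mem_powIdeal_of_splitting {p : ℕ} [Fact p.Prime] [CharP k p] {d e N : ℕ}
    {f : MvPolynomial (Fin 3) k} {a b : Fin 3 → MvPolynomial (Fin 3) k}
    (hf : f.IsHomogeneous d) (hprime : Prime f) (hmonic : (finSuccEquiv k 2 f).Monic)
    (hX : ¬ f ∣ X 1) (he : 0 < e) (ha : ∀ i, (a i).IsHomogeneous e)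
    (hb : ∀ i, (b i).IsHomogeneous e) (hφ : f ∣ aeval (crossProduct a b) f)
    (hker : ∀ h, f ∣ aeval (crossProduct a b) h → f ∣ h)
    (h1 : X 1 ^ N ∈ Ideal.span {f} ⊔ Ideal.span (Set.range (crossProduct a b)))
    (h2 : X 2 ^ N ∈ Ideal.span {f} ⊔ Ideal.span (Set.range (crossProduct a b)))
    {n i : ℕ} {g : MvPolynomial (Fin 3) k} (hi : 2 * i + 2 * d < 3 * p ^ n)
    (hg : g.IsHomogeneous i) (hfg : f * g ∈ powIdeal k (p ^ n)) : g ∈ powIdeal k (p ^ n) := by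
  have hp : p.Prime := Fact.out
  set q := p ^ n with hq
  set G := crossProduct a b with hG
  have hGe : ∀ i, (G i).IsHomogeneous (e + e) := isHomogeneous_cross ha hb
  obtain ⟨c, D, hc, hcD, hsum⟩ : ∃ (c : Fin 3 → MvPolynomial (Fin 3) k) (D : ℕ),
      (∀ j, (c j).IsHomogeneous D) ∧ 2 * D < q ∧ f * g = ∑ j, c j * X j ^ q := by
    obtain ⟨c, hc⟩ := Ideal.mem_span_range_iff_exists_fun.mp hfg
    have hfgh : homogeneousComponent (d + i) (f * g) = f * g := by
      rw [homogeneousComponent_of_mem ((mem_homogeneousSubmodule _ _).mpr (hf.mul hg)), if_pos rfl]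
    rcases le_or_gt q (d + i) with h | h
    · refine ⟨fun j => homogeneousComponent (d + i - q) (c j), d + i - q,
        fun j => homogeneousComponent_isHomogeneous _ _, by omega, ?_⟩
      rw [← hfgh, ← hc, map_sum]
      refine Finset.sum_congr rfl fun j _ => ?_
      rw [mul_comm, homogeneousComponent_mul_of_homogeneous (isHomogeneous_X_pow j q) h, mul_comm]
    · refine ⟨0, 0, fun j => isHomogeneous_zero _ _ _, by simpa using pow_pos hp.pos n, ?_⟩
      rw [← hfgh, ← hc, map_sum]
      refine Finset.sum_congr rfl fun j _ => ?_
      rw [mul_comm, homogeneousComponent_mul_eq_zero (isHomogeneous_X_pow j q) h]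
      simp
  suffices hdiv : ∀ j, f ∣ c j by
    choose s hs using hdiv
    have : g = ∑ j, s j * X j ^ q := by
      refine mul_left_cancel₀ hprime.ne_zero ?_
      rw [hsum, Finset.mul_sum]
      refine Finset.sum_congr rfl fun j _ => ?_
      rw [hs j, mul_assoc]
    rw [this]
    exact Ideal.mem_span_range_iff_exists_fun.mpr ⟨s, rfl⟩
  have hIp : (Ideal.span {f}).IsPrime := (Ideal.span_singleton_prime hprime.ne_zero).mpr hprime
  set π := Ideal.Quotient.mk (Ideal.span {f}) with hπ
  have hz : ∀ s, π s = 0 ↔ f ∣ s := fun s => by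
    rw [hπ, Ideal.Quotient.eq_zero_iff_mem, Ideal.mem_span_singleton]
  have hmapcross : ∀ (u v : Fin 3 → MvPolynomial (Fin 3) k) (j : Fin 3),
      π (crossProduct u v j) = crossProduct (fun i => π (u i)) (fun i => π (v i)) j := by
    intro u v j
    fin_cases j <;> simp [cross_apply]
  obtain ⟨α, hα⟩ := exists_pow_eq_sum_pow (p := p) n h1
  obtain ⟨β, hβ⟩ := exists_pow_eq_sum_pow (p := p) n h2
  set C : Fin 3 → MvPolynomial (Fin 3) k := fun j => aeval G (c j) with hC
  have hCe : ∀ j, (C j).IsHomogeneous ((e + e) * D) := fun j => (hc j).aeval _ hGe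
  have hCG : ∑ j, π (C j) * π (G j) ^ q = 0 := by
    have := congrArg (aeval G) hsum
    rw [map_mul, map_sum] at this
    have h0 : π (aeval G f) = 0 := (hz _).mpr hφ
    have := congrArg π this
    rw [map_mul, h0, zero_mul, map_sum] at this
    rw [this]
    refine Finset.sum_congr rfl fun j _ => ?_
    simp [hC]
  have hdeg : (e + e) * D + e * q < (e + e) * q := by nlinarith
  have hGq : ∀ j, crossProduct (fun i => a i ^ q) (fun i => b i ^ q) j = G j ^ q :=
    fun j => cross_pow_char p n a b j
  have hA : ∀ j, f ∣ crossProduct C (fun i => a i ^ q) j := by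
    refine dvd_of_parallel hf hprime hmonic hX (g := fun j => G j ^ q)
      (isHomogeneous_cross hCe fun i => (ha i).pow q) (fun i => (hGe i).pow q) hdeg ?_ hα hβ
    intro i j
    rw [← hz, map_sub, map_mul, map_mul, sub_eq_zero, ← hGq, ← hGq, hmapcross, hmapcross,
      hmapcross, hmapcross]
    refine cross_parallel ?_ i j
    refine (Finset.sum_congr rfl fun j _ => ?_).trans hCG
    rw [← hmapcross, hGq, map_pow]
  have hB : ∀ j, f ∣ crossProduct C (fun i => b i ^ q) j := by
    refine dvd_of_parallel hf hprime hmonic hX (g := fun j => G j ^ q)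
      (isHomogeneous_cross hCe fun i => (hb i).pow q) (fun i => (hGe i).pow q) hdeg ?_ hα hβ
    intro i j
    have hGq' : ∀ j, crossProduct (fun i => b i ^ q) (fun i => a i ^ q) j = -G j ^ q := by
      intro j
      rw [← hGq, ← cross_anticomm]
      rfl
    have : crossProduct C (fun i => b i ^ q) i * G j ^ q
        - crossProduct C (fun i => b i ^ q) j * G i ^ q
        = -(crossProduct C (fun i => b i ^ q) i * -G j ^ q
          - crossProduct C (fun i => b i ^ q) j * -G i ^ q) := by ring
    rw [this, dvd_neg, ← hz, map_sub, map_mul, map_mul, sub_eq_zero, ← hGq', ← hGq', hmapcross,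
      hmapcross, hmapcross, hmapcross]
    refine cross_parallel ?_ i j
    refine (Finset.sum_congr rfl fun j _ => ?_).trans
      ((Finset.sum_neg_distrib _).trans (neg_eq_zero.mpr hCG))
    rw [← hmapcross, hGq', map_neg, map_pow]
    ring
  intro j
  apply hker
  rw [← hz]
  have hzero : (fun i => π (C i)) = 0 := by
    refine eq_zero_of_cross_eq_zero (a := fun i => π (a i ^ q)) (b := fun i => π (b i ^ q)) ?_ ?_ ?_
    · ext l
      rw [← hmapcross, Pi.zero_apply, hz]
      exact hA l
    · ext l
      rw [← hmapcross, Pi.zero_apply, hz]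
      exact hB l
    · intro hall
      have hall' : ∀ l, π (G l ^ q) = 0 := fun l => by
        rw [← hGq, hmapcross, hall, Pi.zero_apply]
      refine hX (hprime.dvd_of_dvd_pow (n := N * q) ?_)
      rw [← hz] at hα ⊢
      rw [map_sub, map_sum, sub_eq_zero] at hα
      rw [hα]
      simp only [map_mul]
      exact Finset.sum_eq_zero fun l _ => by rw [hall' l, mul_zero]
  exact congrFun hzero j

end Splitting

section Kernel

variable {k : Type*} [Field k]

theorem finSuccEquiv_rename_succ (n : MvPolynomial (Fin 2) k) :
    finSuccEquiv k 2 (rename Fin.succ n) = Polynomial.C n := by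
  induction n using MvPolynomial.induction_on with
  | C a => simp [finSuccEquiv_apply]
  | add a b ha hb => rw [map_add, map_add, map_add, ha, hb]
  | mul_X a j ha => rw [map_mul, map_mul, map_mul, ha, rename_X, finSuccEquiv_X_succ]

theorem exists_ne_zero_dvd_aeval {f h : MvPolynomial (Fin 3) k} (hprime : Prime f)
    (hmonic : (finSuccEquiv k 2 f).Monic) (hfh : ¬ f ∣ h) :
    ∃ n : MvPolynomial (Fin 2) k, n ≠ 0 ∧ ∃ s t, rename Fin.succ n = f * s + h * t := by
  set E := finSuccEquiv k 2 with hE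
  have hF : Prime (E f) := (MulEquiv.prime_iff E).mpr hprime
  have hI : (Ideal.span {E f}).IsPrime := (Ideal.span_singleton_prime hF.ne_zero).mpr hF
  set π := Ideal.Quotient.mk (Ideal.span {E f}) with hπ
  have hz : ∀ s, π s = 0 ↔ E f ∣ s := fun s => by
    rw [hπ, Ideal.Quotient.eq_zero_iff_mem, Ideal.mem_span_singleton]
  have hne : π (E h) ≠ 0 := fun h0 => hfh ((map_dvd_iff E).mp ((hz _).mp h0))
  have hint : IsIntegral (MvPolynomial (Fin 2) k) (π (E h)) :=
    Polynomial.Monic.quotient_isIntegral hmonic (Ideal.mem_span_singleton_self _) _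
  have hbot := Ideal.comap_ne_bot_of_integral_mem (I := Ideal.span {π (E h)}) hne
    (Ideal.mem_span_singleton_self _) hint
  obtain ⟨n, hn, hn0⟩ := Submodule.exists_mem_ne_zero_of_ne_bot hbot
  refine ⟨n, hn0, ?_⟩
  obtain ⟨t', ht'⟩ := Ideal.mem_span_singleton.mp (Ideal.mem_comap.mp hn)
  obtain ⟨t, rfl⟩ := Ideal.Quotient.mk_surjective t'
  have hdvd : E f ∣ Polynomial.C n - E h * t := by
    rw [← hz, map_sub, map_mul, sub_eq_zero]
    exact ht'
  obtain ⟨s, hs⟩ := hdvd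
  refine ⟨E.symm s, E.symm t, E.injective ?_⟩
  rw [map_add, map_mul, map_mul, AlgEquiv.apply_symm_apply, AlgEquiv.apply_symm_apply, hE,
    finSuccEquiv_rename_succ, ← hE, ← hs]
  ring

theorem X_zero_dvd_of_aeval_eq_zero {n : MvPolynomial (Fin 2) k}
    (hn : aeval ![0, (Polynomial.X : Polynomial k)] n = 0) : X 0 ∣ n := by
  set π := Ideal.Quotient.mkₐ k (Ideal.span {(X 0 : MvPolynomial (Fin 2) k)}) with hπ
  have hX : π (X 0) = 0 := Ideal.Quotient.eq_zero_iff_mem.mpr (Ideal.mem_span_singleton_self _)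
  have key : π = (π.comp (Polynomial.aeval (X 1))).comp
      (aeval ![0, (Polynomial.X : Polynomial k)]) := by
    refine algHom_ext fun i => ?_
    fin_cases i
    · simpa using hX
    · simp
  rw [← Ideal.mem_span_singleton, ← Ideal.Quotient.eq_zero_iff_mem]
  change π n = 0
  rw [key, AlgHom.comp_apply, hn, map_zero]

theorem eq_zero_of_dvd_aeval {f : MvPolynomial (Fin 3) k} (hprime : Prime f)
    {G : Fin 2 → MvPolynomial (Fin 3) k} (hG : ¬ f ∣ G 0)
    (ev : MvPolynomial (Fin 3) k →ₐ[k] Polynomial k) (hevf : ev f = 0) (hev0 : ev (G 0) = 0)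
    (hev1 : (ev (G 1)).natDegree ≠ 0) (n : MvPolynomial (Fin 2) k) (hn : f ∣ aeval (R := k) G n) :
    n = 0 := by
  induction hN : n.totalDegree using Nat.strong_induction_on generalizing n with
  | _ N ih =>
    by_contra hn0
    have hcomp : (aeval ![0, (Polynomial.X : Polynomial k)] n).comp (ev (G 1)) = 0 := by
      obtain ⟨s, hs⟩ := hn
      have h1 : ev (aeval (R := k) G n) = 0 := by rw [hs, map_mul, hevf, zero_mul]
      have h2 : (Polynomial.compRingHom (ev (G 1))).comp
          (aeval ![0, (Polynomial.X : Polynomial k)]).toRingHom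
          = ev.toRingHom.comp (aeval (R := k) G).toRingHom := by
        refine ringHom_ext (fun r => ?_) fun i => ?_
        · simp [← algebraMap_eq]
        · fin_cases i <;> simp [hev0]
      have := congrArg (fun φ : MvPolynomial (Fin 2) k →+* Polynomial k => φ n) h2
      exact this.trans h1
    have hzero : aeval ![0, (Polynomial.X : Polynomial k)] n = 0 := by
      refine (Polynomial.comp_eq_zero_iff.mp hcomp).resolve_right fun h => hev1 ?_
      rw [h.2, Polynomial.natDegree_C]
    obtain ⟨m, rfl⟩ := X_zero_dvd_of_aeval_eq_zero hzero
    have hm0 : m ≠ 0 := right_ne_zero_of_mul hn0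
    rw [map_mul, aeval_X] at hn
    have hm := (hprime.dvd_or_dvd hn).resolve_left hG
    refine hm0 (ih m.totalDegree ?_ m hm rfl)
    rw [← hN, totalDegree_mul_of_isDomain (X_ne_zero 0) hm0, totalDegree_X]
    omega

theorem dvd_of_dvd_aeval {f : MvPolynomial (Fin 3) k} (hprime : Prime f)
    (hmonic : (finSuccEquiv k 2 f).Monic) {G : Fin 3 → MvPolynomial (Fin 3) k}
    (hφ : f ∣ aeval G f) (hG : ¬ f ∣ G 1) (ev : MvPolynomial (Fin 3) k →ₐ[k] Polynomial k)
    (hevf : ev f = 0) (hev1 : ev (G 1) = 0) (hev2 : (ev (G 2)).natDegree ≠ 0)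
    (h : MvPolynomial (Fin 3) k) (hh : f ∣ aeval G h) : f ∣ h := by
  by_contra hfh
  obtain ⟨n, hn0, s, t, hst⟩ := exists_ne_zero_dvd_aeval hprime hmonic hfh
  refine hn0 (eq_zero_of_dvd_aeval hprime (G := fun j => G j.succ) hG ev hevf hev1 hev2 n ?_)
  have := congrArg (aeval G) hst
  rw [aeval_rename, map_add, map_mul, map_mul] at this
  change aeval (G ∘ Fin.succ) n = _ at this
  change f ∣ aeval (G ∘ Fin.succ) n
  rw [this]
  exact dvd_add (hφ.mul_right _) (hh.mul_right _)

end Kernel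

section Conic

variable {k : Type*} [Field k]

theorem prime_of_forall_eval_ne_zero {f : MvPolynomial (Fin 3) k}
    (hmonic : (finSuccEquiv k 2 f).Monic) (h2 : 2 ≤ (finSuccEquiv k 2 f).natDegree)
    (h3 : (finSuccEquiv k 2 f).natDegree ≤ 3)
    (hroot : ∀ r, (finSuccEquiv k 2 f).eval r ≠ 0) : Prime f := by
  refine Irreducible.prime ((MulEquiv.irreducible_iff (finSuccEquiv k 2)).mp ?_)
  rw [hmonic.irreducible_iff_roots_eq_zero_of_degree_le_three h2 h3]
  exact Multiset.eq_zero_of_forall_notMem fun r hr => hroot r (Polynomial.isRoot_of_mem_roots hr)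

theorem not_dvd_of_aeval {σ B : Type*} [CommRing B] [Algebra k B] {f h : MvPolynomial σ k}
    (v : σ → B) (hf : aeval v f = 0) (hh : aeval v h ≠ 0) : ¬ f ∣ h := by
  rintro ⟨s, rfl⟩
  rw [map_mul, hf, zero_mul] at hh
  exact hh rfl

/-- The smooth conic `x² - yz`. -/
noncomputable def conic (k : Type*) [Field k] : MvPolynomial (Fin 3) k := X 0 ^ 2 - X 1 * X 2

theorem isHomogeneous_conic : (conic k).IsHomogeneous 2 :=
  (isHomogeneous_X_pow 0 2).sub ((isHomogeneous_X k 1).mul (isHomogeneous_X k 2))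

theorem finSuccEquiv_conic :
    finSuccEquiv k 2 (conic k) = Polynomial.X ^ 2 - Polynomial.C (X 0 * X 1) := by
  have h1 : finSuccEquiv k 2 (X 1) = Polynomial.C (X 0) := finSuccEquiv_X_succ (j := 0)
  have h2 : finSuccEquiv k 2 (X 2) = Polynomial.C (X 1) := finSuccEquiv_X_succ (j := 1)
  rw [conic, map_sub, map_pow, map_mul, h1, h2, finSuccEquiv_X_zero, map_mul]

theorem monic_conic : (finSuccEquiv k 2 (conic k)).Monic := by
  rw [finSuccEquiv_conic]
  exact Polynomial.monic_X_pow_sub_C _ two_ne_zero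

theorem prime_conic : Prime (conic k) := by
  have hdeg : (finSuccEquiv k 2 (conic k)).natDegree = 2 := by
    rw [finSuccEquiv_conic, Polynomial.natDegree_X_pow_sub_C]
  refine prime_of_forall_eval_ne_zero monic_conic hdeg.ge (by omega) fun r hr => ?_
  have := congrArg (aeval ![(Polynomial.X : Polynomial k), 1]) hr
  simp only [finSuccEquiv_conic, Polynomial.eval_sub, Polynomial.eval_pow, Polynomial.eval_X,
    Polynomial.eval_mul,
    Polynomial.eval_C, map_sub, map_pow, map_mul, aeval_X, Matrix.cons_val_zero,
    Matrix.cons_val_one, mul_one, map_zero, sub_eq_zero] at this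
  have := congrArg Polynomial.natDegree this
  rw [Polynomial.natDegree_pow, Polynomial.natDegree_X] at this
  omega

theorem cross_conic : crossProduct (![X 1, -X 2, 0] : Fin 3 → MvPolynomial (Fin 3) k)
    ![X 2, 0, -X 1] = ![X 1 * X 2, X 1 ^ 2, X 2 ^ 2] := by
  rw [cross_apply]
  ext1 i
  fin_cases i <;> simp <;> ring

theorem mem_powIdeal_of_conic_mul_mem {p : ℕ} [Fact p.Prime] [CharP k p] {n i : ℕ}
    {g : MvPolynomial (Fin 3) k} (hi : 2 * i + 4 < 3 * p ^ n) (hg : g.IsHomogeneous i)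
    (hfg : conic k * g ∈ powIdeal k (p ^ n)) : g ∈ powIdeal k (p ^ n) := by
  have h111 : aeval (fun _ => (1 : k)) (conic k) = 0 := by simp [conic]
  have hφ : conic k ∣ aeval (![X 1 * X 2, X 1 ^ 2, X 2 ^ 2] : Fin 3 → MvPolynomial (Fin 3) k)
      (conic k) := by
    convert dvd_zero _
    simp only [conic, map_sub, map_pow, map_mul, aeval_X, Matrix.cons_val_zero,
      Matrix.cons_val_one, Matrix.cons_val]
    ring
  refine mem_powIdeal_of_splitting (e := 1) (N := 2) (a := ![X 1, -X 2, 0]) (b := ![X 2, 0, -X 1])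
    isHomogeneous_conic prime_conic monic_conic
    (not_dvd_of_aeval (fun _ => (1 : k)) h111 (by simp)) one_pos ?_ ?_ ?_ ?_ ?_ ?_ hi hg hfg
  · intro j
    fin_cases j
    exacts [isHomogeneous_X k 1, (isHomogeneous_X k 2).neg, isHomogeneous_zero _ _ _]
  · intro j
    fin_cases j
    exacts [isHomogeneous_X k 2, isHomogeneous_zero _ _ _, (isHomogeneous_X k 1).neg]
  · rwa [cross_conic]
  · rw [cross_conic]
    refine dvd_of_dvd_aeval prime_conic monic_conic hφ
      (not_dvd_of_aeval (fun _ => (1 : k)) h111 (by simp))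
      (aeval ![0, 0, Polynomial.X]) ?_ ?_ ?_
    · simp [conic]
    · simp
    · simp
  · rw [cross_conic]
    exact Ideal.mem_sup_right (Ideal.subset_span ⟨1, rfl⟩)
  · rw [cross_conic]
    exact Ideal.mem_sup_right (Ideal.subset_span ⟨2, rfl⟩)

end Conic

section Cubic

variable {k : Type*} [Field k]

/-- The cubic `x³ + y³ + z³ + l xyz`, in Hesse form. -/
noncomputable def cubic (l : k) : MvPolynomial (Fin 3) k :=
  X 0 ^ 3 + X 1 ^ 3 + X 2 ^ 3 + C l * (X 0 * X 1 * X 2)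

theorem isHomogeneous_cubic (l : k) : (cubic l).IsHomogeneous 3 := by
  refine (((isHomogeneous_X_pow 0 3).add (isHomogeneous_X_pow 1 3)).add
    (isHomogeneous_X_pow 2 3)).add ?_
  simpa using (isHomogeneous_C (Fin 3) l).mul
    (((isHomogeneous_X k 0).mul (isHomogeneous_X k 1)).mul (isHomogeneous_X k 2))

theorem finSuccEquiv_cubic (l : k) :
    finSuccEquiv k 2 (cubic l) = Polynomial.X ^ 3 +
      (Polynomial.C (C l * X 0 * X 1) * Polynomial.X + Polynomial.C (X 0 ^ 3 + X 1 ^ 3)) := by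
  have h1 : finSuccEquiv k 2 (X 1) = Polynomial.C (X 0) := finSuccEquiv_X_succ (j := 0)
  have h2 : finSuccEquiv k 2 (X 2) = Polynomial.C (X 1) := finSuccEquiv_X_succ (j := 1)
  have h3 : finSuccEquiv k 2 (C l) = Polynomial.C (C l) := by
    simp [finSuccEquiv_apply]
  simp only [cubic, map_add, map_pow, map_mul, h1, h2, h3, finSuccEquiv_X_zero]
  ring

theorem degree_cubic_tail_lt (l : k) :
    (Polynomial.C (C l * X 0 * X 1) * Polynomial.X + Polynomial.C (X 0 ^ 3 + X 1 ^ 3) :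
      Polynomial (MvPolynomial (Fin 2) k)).degree < (3 : ℕ) :=
  Polynomial.degree_linear_le.trans_lt (by norm_num)

theorem monic_cubic (l : k) : (finSuccEquiv k 2 (cubic l)).Monic := by
  rw [finSuccEquiv_cubic]
  exact Polynomial.monic_X_pow_add (degree_cubic_tail_lt l)

theorem pow_three_add_ne_zero {l : k} (hl : 27 + l ^ 3 ≠ 0) (s : Polynomial k) :
    s ^ 3 + (Polynomial.C l * Polynomial.X * s + (1 + Polynomial.X ^ 3)) ≠ 0 := by
  intro hs
  have hdeg : s.natDegree ≤ 1 := by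
    have h1 : s ^ 3 = -(Polynomial.C l * Polynomial.X * s + (1 + Polynomial.X ^ 3)) :=
      eq_neg_of_add_eq_zero_left hs
    have h2 := congrArg Polynomial.natDegree h1
    rw [Polynomial.natDegree_pow, Polynomial.natDegree_neg] at h2
    have h3 : (Polynomial.C l * Polynomial.X * s + (1 + Polynomial.X ^ 3)).natDegree
        ≤ max (1 + s.natDegree) 3 := by
      refine (Polynomial.natDegree_add_le _ _).trans (max_le_max ?_ ?_)
      · exact Polynomial.natDegree_mul_le.trans
          (Nat.add_le_add_right (by compute_degree) _)
      · compute_degree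
    omega
  obtain ⟨α, β, rfl⟩ := Polynomial.exists_eq_X_add_C_of_natDegree_le_one hdeg
  have hs' : Polynomial.C (α ^ 3 + 1) * Polynomial.X ^ 3
      + Polynomial.C (3 * α ^ 2 * β + l * α) * Polynomial.X ^ 2
      + Polynomial.C (3 * α * β ^ 2 + l * β) * Polynomial.X + Polynomial.C (β ^ 3 + 1) = 0 := by
    rw [← hs]
    simp only [map_add, map_mul, map_pow, map_one, map_ofNat]
    ring
  have c3 := congrArg (Polynomial.coeff · 3) hs'
  have c2 := congrArg (Polynomial.coeff · 2) hs'
  have c0 := congrArg (Polynomial.coeff · 0) hs'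
  simp [Polynomial.coeff_X, Polynomial.coeff_C, Polynomial.coeff_X_pow, -map_add, -map_mul,
    -map_pow] at c3 c2 c0
  have hα : α ≠ 0 := by
    rintro rfl
    simp at c3
  have hl' : l = -3 * α * β := by
    refine mul_right_cancel₀ hα ?_
    linear_combination c2
  apply hl
  rw [hl']
  linear_combination (-27 * β ^ 3) * c3 + 27 * c0

theorem prime_cubic {l : k} (hl : 27 + l ^ 3 ≠ 0) : Prime (cubic l) := by
  have hdeg : (finSuccEquiv k 2 (cubic l)).natDegree = 3 := by
    rw [finSuccEquiv_cubic]
    refine Polynomial.natDegree_eq_of_degree_eq_some ?_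
    rw [Polynomial.degree_add_eq_left_of_degree_lt, Polynomial.degree_X_pow]
    rw [Polynomial.degree_X_pow]
    exact degree_cubic_tail_lt l
  refine prime_of_forall_eval_ne_zero (monic_cubic l) (by omega) hdeg.le fun r hr => ?_
  have := congrArg (aeval ![1, (Polynomial.X : Polynomial k)]) hr
  apply pow_three_add_ne_zero hl (aeval ![1, (Polynomial.X : Polynomial k)] r)
  rw [map_zero] at this
  rw [← this, finSuccEquiv_cubic]
  simp only [Polynomial.eval_add, Polynomial.eval_pow, Polynomial.eval_X, Polynomial.eval_mul,
    Polynomial.eval_C, map_add, map_pow, map_mul, aeval_X, aeval_C, Matrix.cons_val_zero,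
    Matrix.cons_val_one]
  simp [Polynomial.algebraMap_eq]

theorem pow_sixteen_eq_zero {A : Type*} [CommRing A] {x y z l : A} (hl : IsUnit (27 + l ^ 3))
    (h0 : x * z ^ 3 = x * y ^ 3) (h1 : y * x ^ 3 = y * z ^ 3) (h2 : z * x ^ 3 = z * y ^ 3)
    (hf : x ^ 3 + y ^ 3 + z ^ 3 + l * (x * y * z) = 0) : x ^ 16 = 0 := by
  set m := x * y * z with hm
  have e1 : m * y ^ 3 = m * x ^ 3 := by
    rw [hm]
    linear_combination -(x * y) * h2
  have e2 : m * z ^ 3 = m * x ^ 3 := by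
    rw [hm]
    linear_combination -(x * z) * h1
  have e3 : 3 * (m * x ^ 3) = -(l * m ^ 2) := by
    linear_combination m * hf - e1 - e2
  have e4 : m ^ 4 = m * x ^ 9 := by
    calc m ^ 4 = (m * y ^ 3) * (x ^ 3 * z ^ 3) := by rw [hm]; ring
      _ = (m * z ^ 3) * x ^ 6 := by rw [e1]; ring
      _ = m * x ^ 9 := by rw [e2]; ring
  have e5 : m * x ^ 9 = 0 := by
    refine hl.mul_right_eq_zero.mp ?_
    linear_combination (9 * x ^ 6 - 3 * l * m * x ^ 3 + l ^ 2 * m ^ 2) * e3 - l ^ 3 * e4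
  have e6 : x ^ 13 * y ^ 3 = 0 := by
    linear_combination x ^ 10 * y ^ 2 * h1 + y ^ 2 * z ^ 2 * e5
  have e7 : x ^ 13 * z ^ 3 = 0 := by
    linear_combination e6 + x ^ 12 * h0
  linear_combination x ^ 13 * hf - e6 - e7 - l * x ^ 4 * e5

theorem cross_cubic : crossProduct
    (![X 1 * X 2, X 2 * X 0, X 0 * X 1] : Fin 3 → MvPolynomial (Fin 3) k)
    ![X 0 ^ 2, X 1 ^ 2, X 2 ^ 2]
    = ![X 0 * (X 2 ^ 3 - X 1 ^ 3), X 1 * (X 0 ^ 3 - X 2 ^ 3), X 2 * (X 1 ^ 3 - X 0 ^ 3)] := by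
  rw [cross_apply]
  ext1 i
  fin_cases i <;> simp <;> ring

theorem X_pow_sixteen_mem {l : k} (hl : 27 + l ^ 3 ≠ 0) (i : Fin 3) :
    (X i ^ 16 : MvPolynomial (Fin 3) k) ∈ Ideal.span {cubic l} ⊔ Ideal.span (Set.range
      ![X 0 * (X 2 ^ 3 - X 1 ^ 3), X 1 * (X 0 ^ 3 - X 2 ^ 3), X 2 * (X 1 ^ 3 - X 0 ^ 3)]) := by
  set G : Fin 3 → MvPolynomial (Fin 3) k :=
    ![X 0 * (X 2 ^ 3 - X 1 ^ 3), X 1 * (X 0 ^ 3 - X 2 ^ 3), X 2 * (X 1 ^ 3 - X 0 ^ 3)] with hG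
  set π := Ideal.Quotient.mk (Ideal.span {cubic l} ⊔ Ideal.span (Set.range G)) with hπ
  have hGz : ∀ j, π (G j) = 0 := fun j =>
    Ideal.Quotient.eq_zero_iff_mem.mpr (Ideal.mem_sup_right (Ideal.subset_span ⟨j, rfl⟩))
  have hfz : π (cubic l) = 0 :=
    Ideal.Quotient.eq_zero_iff_mem.mpr (Ideal.mem_sup_left (Ideal.mem_span_singleton_self _))
  have h0 : π (X 0) * (π (X 2) ^ 3 - π (X 1) ^ 3) = 0 := by simpa [hG] using hGz 0
  have h1 : π (X 1) * (π (X 0) ^ 3 - π (X 2) ^ 3) = 0 := by simpa [hG] using hGz 1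
  have h2 : π (X 2) * (π (X 1) ^ 3 - π (X 0) ^ 3) = 0 := by simpa [hG] using hGz 2
  have hf : π (X 0) ^ 3 + π (X 1) ^ 3 + π (X 2) ^ 3
      + π (C l) * (π (X 0) * π (X 1) * π (X 2)) = 0 := by
    have : π (X 0 ^ 3 + X 1 ^ 3 + X 2 ^ 3 + C l * (X 0 * X 1 * X 2)) = 0 := hfz
    simpa only [map_add, map_pow, map_mul] using this
  have hu : IsUnit (27 + π (C l) ^ 3) := by
    have := (isUnit_iff_ne_zero.mpr hl).map (π.comp C)
    simpa only [RingHom.comp_apply, map_add, map_pow, map_ofNat] using this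
  rw [← Ideal.Quotient.eq_zero_iff_mem, map_pow]
  obtain rfl | rfl | rfl : i = 0 ∨ i = 1 ∨ i = 2 := by fin_cases i <;> simp
  · exact pow_sixteen_eq_zero hu (y := π (X 1)) (z := π (X 2)) (by linear_combination h0)
      (by linear_combination h1) (by linear_combination -h2) hf
  · exact pow_sixteen_eq_zero hu (y := π (X 0)) (z := π (X 2)) (by linear_combination -h1)
      (by linear_combination -h0) (by linear_combination h2) (by linear_combination hf)
  · exact pow_sixteen_eq_zero hu (y := π (X 1)) (z := π (X 0)) (by linear_combination -h2)
      (by linear_combination -h1) (by linear_combination h0) (by linear_combination hf)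

theorem mem_powIdeal_of_cubic_mul_mem {p : ℕ} [Fact p.Prime] [CharP k p] {l : k}
    (hl : 27 + l ^ 3 ≠ 0) {n i : ℕ} {g : MvPolynomial (Fin 3) k} (hi : 2 * i + 6 < 3 * p ^ n)
    (hg : g.IsHomogeneous i) (hfg : cubic l * g ∈ powIdeal k (p ^ n)) :
    g ∈ powIdeal k (p ^ n) := by
  have hpt : aeval (![1, -1, 0] : Fin 3 → k) (cubic l) = 0 := by
    simp [cubic, Odd.neg_one_pow (show Odd 3 by decide)]
  have hφ : cubic l ∣ aeval
      (![X 0 * (X 2 ^ 3 - X 1 ^ 3), X 1 * (X 0 ^ 3 - X 2 ^ 3), X 2 * (X 1 ^ 3 - X 0 ^ 3)] :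
        Fin 3 → MvPolynomial (Fin 3) k) (cubic l) := by
    refine ⟨(X 2 ^ 3 - X 1 ^ 3) * (X 0 ^ 3 - X 2 ^ 3) * (X 1 ^ 3 - X 0 ^ 3), ?_⟩
    simp only [cubic, map_add, map_pow, map_mul, aeval_X, aeval_C, algebraMap_eq,
      Matrix.cons_val_zero, Matrix.cons_val_one, Matrix.cons_val]
    ring
  refine mem_powIdeal_of_splitting (e := 2) (N := 16) (a := ![X 1 * X 2, X 2 * X 0, X 0 * X 1])
    (b := ![X 0 ^ 2, X 1 ^ 2, X 2 ^ 2]) (isHomogeneous_cubic l) (prime_cubic hl) (monic_cubic l)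
    (not_dvd_of_aeval ![1, -1, 0] hpt (by simp)) two_pos ?_ ?_ ?_ ?_ ?_ ?_ hi hg hfg
  · intro j
    fin_cases j
    exacts [(isHomogeneous_X k 1).mul (isHomogeneous_X k 2),
      (isHomogeneous_X k 2).mul (isHomogeneous_X k 0),
      (isHomogeneous_X k 0).mul (isHomogeneous_X k 1)]
  · intro j
    fin_cases j
    exacts [isHomogeneous_X_pow 0 2, isHomogeneous_X_pow 1 2, isHomogeneous_X_pow 2 2]
  · rwa [cross_cubic]
  · rw [cross_cubic]
    refine dvd_of_dvd_aeval (prime_cubic hl) (monic_cubic l) hφ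
      (not_dvd_of_aeval ![1, -1, 0] hpt (by simp))
      (aeval ![Polynomial.X, 0, -Polynomial.X]) ?_ ?_ ?_
    · simp [cubic, Odd.neg_pow (show Odd 3 by decide)]
    · simp
    · simp
  · rw [cross_cubic]
    exact X_pow_sixteen_mem hl 1
  · rw [cross_cubic]
    exact X_pow_sixteen_mem hl 2

end Cubic

section Construction

variable {k : Type*} [Field k]

theorem coeff_single_mul {σ : Type*} {m n : ℕ} {f g : MvPolynomial σ k} (hf : f.IsHomogeneous m)
    (i : σ) : coeff (Finsupp.single i (m + n)) (f * g)
      = coeff (Finsupp.single i m) f * coeff (Finsupp.single i n) g := by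
  classical
  rw [coeff_mul, Finsupp.antidiagonal_single, Finset.sum_map,
    Finset.sum_eq_single_of_mem (m, n) (by simp)]
  · rfl
  · rintro ⟨u, v⟩ huv hne
    rw [Finset.HasAntidiagonal.mem_antidiagonal] at huv
    have : u ≠ m := by
      rintro rfl
      exact hne (Prod.ext rfl (Nat.add_left_cancel huv))
    have hz : coeff (Finsupp.single i u) f = 0 := hf.coeff_eq_zero (by simpa using this)
    simp [hz]

theorem exists_homogeneous_injective (p : ℕ) [Fact p.Prime] [CharP k p] {d : ℕ} (hd : 2 ≤ d) :
    ∃ (f : MvPolynomial (Fin 3) k) (c : ℕ), f.IsHomogeneous d ∧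
      coeff (Finsupp.single 0 d) f = 1 ∧
      ∀ (n i : ℕ) (g : MvPolynomial (Fin 3) k), 2 * i + c < 3 * p ^ n → g.IsHomogeneous i →
        f * g ∈ powIdeal k (p ^ n) → g ∈ powIdeal k (p ^ n) := by
  induction d using Nat.strong_induction_on with
  | _ d ih =>
    have hs : ∀ {i : Fin 3} {m n : ℕ} , i ≠ 0 → n ≠ 0 →
        coeff (Finsupp.single 0 m) (X i ^ n : MvPolynomial (Fin 3) k) = 0 := by
      intro i m n hi hn
      rw [X_pow_eq_monomial, coeff_monomial, if_neg]
      intro h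
      have := DFunLike.congr_fun h i
      simp [hi.symm] at this
      omega
    have hx : ∀ n, coeff (Finsupp.single 0 n) (X 0 ^ n : MvPolynomial (Fin 3) k) = 1 := by
      intro n
      rw [X_pow_eq_monomial, coeff_monomial, if_pos rfl]
    have hx1 : coeff (Finsupp.single 0 1) (X 1 : MvPolynomial (Fin 3) k) = 0 := by simp
    have hconic : coeff (Finsupp.single 0 2) (conic k) = 1 := by
      rw [conic, coeff_sub, hx, coeff_single_mul (m := 1) (n := 1) (isHomogeneous_X k 1), hx1,
        zero_mul, sub_zero]
    rcases (by omega : d = 2 ∨ d = 3 ∨ 4 ≤ d) with rfl | rfl | h4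
    · exact ⟨conic k, 4, isHomogeneous_conic, hconic,
        fun n i g hi hg hfg => mem_powIdeal_of_conic_mul_mem hi hg hfg⟩
    · obtain ⟨l, hl⟩ : ∃ l : k, 27 + l ^ 3 ≠ 0 := by
        by_cases h27 : (27 : k) = 0
        · exact ⟨1, by simp [h27]⟩
        · exact ⟨0, by simpa using h27⟩
      refine ⟨cubic l, 6, isHomogeneous_cubic l, ?_,
        fun n i g hi hg hfg => mem_powIdeal_of_cubic_mul_mem hl hi hg hfg⟩
      have hxyz : coeff (Finsupp.single 0 3) (X 0 * X 1 * X 2 : MvPolynomial (Fin 3) k) = 0 := by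
        rw [show (X 0 * X 1 * X 2 : MvPolynomial (Fin 3) k) = X 1 * (X 0 * X 2) by ring,
          coeff_single_mul (m := 1) (n := 2) (isHomogeneous_X k 1), hx1, zero_mul]
      rw [cubic, coeff_add, coeff_add, coeff_add, hx, hs (by decide) (by decide),
        hs (by decide) (by decide), coeff_C_mul, hxyz]
      simp
    · obtain ⟨f, c, hf, hf1, hinj⟩ := ih (d - 2) (by omega) (by omega)
      refine ⟨f * conic k, c + 4, ?_, ?_, fun n i g hi hg hfg => ?_⟩
      · simpa [show d - 2 + 2 = d by omega] using hf.mul isHomogeneous_conic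
      · have := coeff_single_mul (n := 2) (g := conic k) hf 0
        rwa [hf1, hconic, mul_one, show d - 2 + 2 = d by omega] at this
      · rw [mul_assoc] at hfg
        exact mem_powIdeal_of_conic_mul_mem (by omega) hg
          (hinj n (2 + i) _ (by omega) (isHomogeneous_conic.mul hg) hfg)

end Construction

/-- **Minimal Hilbert-Kunz multiplicity of plane curves.**
For any field `k` of prime characteristic `p` and any degree `d ≥ 2`, there is a nonzero
homogeneous `f ∈ k[x,y,z]` of degree `d` whose Hilbert-Kunz multiplicity
`lim_n dim_k k[x,y,z]/(f, x^{pⁿ}, y^{pⁿ}, z^{pⁿ}) / p^{2n}` equals `3d/4`. -/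
theorem exists_plane_curve_minimal_hilbert_kunz_multiplicity
    (k : Type*) [Field k] (p : ℕ) [Fact p.Prime] [CharP k p] (d : ℕ) (hd : 2 ≤ d) :
    ∃ f : MvPolynomial (Fin 3) k, f ≠ 0 ∧ f.IsHomogeneous d ∧
      Filter.Tendsto
        (fun n : ℕ =>
          (Module.finrank k (MvPolynomial (Fin 3) k ⧸
              Ideal.span {f, X 0 ^ p ^ n, X 1 ^ p ^ n, X 2 ^ p ^ n}) : ℝ) / (p : ℝ) ^ (2 * n))
        Filter.atTop (nhds (3 * d / 4)) := by
  obtain ⟨f, c, hf, hf1, hinj⟩ := exists_homogeneous_injective (k := k) p hd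
  refine ⟨f, ?_, hf, ?_⟩
  · rintro rfl
    simp at hf1
  · have hI : ∀ n, Ideal.span {f, X 0 ^ p ^ n, X 1 ^ p ^ n, X 2 ^ p ^ n}
        = Ideal.span {f} ⊔ powIdeal k (p ^ n) := by
      intro n
      have hr : (Set.range fun i : Fin 3 => (X i ^ p ^ n : MvPolynomial (Fin 3) k))
          = {X 0 ^ p ^ n, X 1 ^ p ^ n, X 2 ^ p ^ n} := by
        ext a
        simp [Fin.exists_fin_succ, eq_comm]
      rw [powIdeal, hr, ← Ideal.span_union, Set.singleton_union]
    refine (tendsto_of_homogeneous_injective (Fact.out : p.Prime).one_lt hf hf1 hinj).congr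
      fun n => ?_
    rw [hI]
end

section
/- Let k be an algebraically closed field of odd characteristic p and let f ∈ k[x,y] be a polynomial of total degree 3 whose homogenization F ∈ k[x,y,z] has the property that F and its three partial derivatives have no common zero in k³ other than (0,0,0) (so f defines an elliptic curve in the affine plane). Let q = pⁿ for some n ≥ 0. If u, v, w ∈ k[x,y] are polynomials each of total degree at most (q−1)/2 such that f divides u·x^q + v·y^q + w, then f divides each of u, v, and w. -/
open MvPolynomial

section quartic
open Polynomial QuadraticAlgebra

/-- The quartic `x⁴ + α x² + β`. -/
noncomputable def evenQuartic {k : Type*} [Field k] (α β : k) : k[X] :=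
  Polynomial.X ^ 4 + Polynomial.C α * Polynomial.X ^ 2 + Polynomial.C β

/-- The coordinate ring of the affine curve `ω² = x⁴ + α x² + β`. -/
abbrev DoubleCover {k : Type*} [Field k] (α β : k) : Type _ :=
  QuadraticAlgebra k[X] (evenQuartic α β) 0

theorem natDegree_evenQuartic {k : Type*} [Field k] (α β : k) :
    (evenQuartic α β).natDegree = 4 := by
  unfold evenQuartic
  compute_degree!

theorem exists_simple_root_evenQuartic {k : Type*} [Field k] [IsAlgClosed k] (h2 : (2 : k) ≠ 0)
    {α β : k} (hβ : β ≠ 0) (hαβ : α ^ 2 ≠ 4 * β) :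
    ∃ (e : k) (P : k[X]),
      evenQuartic α β = (Polynomial.X - Polynomial.C e) * P ∧ P.eval e ≠ 0 := by
  obtain ⟨r, hr⟩ := IsAlgClosed.exists_pow_nat_eq (α ^ 2 - 4 * β) (n := 2) (by norm_num)
  obtain ⟨e, he⟩ := IsAlgClosed.exists_pow_nat_eq ((r - α) / 2) (n := 2) (by norm_num)
  have he' : 2 * e ^ 2 = r - α := by rw [he]; field_simp
  have hβe : β = -(e ^ 2 * (e ^ 2 + α)) := by
    have h4 : (4 : k) ≠ 0 := by
      rw [show (4 : k) = 2 * 2 by norm_num]; exact mul_ne_zero h2 h2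
    apply mul_left_cancel₀ h4
    linear_combination hr + (r + 2 * e ^ 2 + α) * he'
  refine ⟨e, Polynomial.X ^ 3 + Polynomial.C e * Polynomial.X ^ 2
    + Polynomial.C (e ^ 2 + α) * Polynomial.X + Polynomial.C (e * (e ^ 2 + α)), ?_, ?_⟩
  · rw [evenQuartic, hβe]
    simp only [map_neg, map_mul, map_add, map_pow]
    ring
  · have hr0 : r ≠ 0 := by
      rintro rfl
      apply hαβ
      linear_combination -hr
    have he0 : e ≠ 0 := by
      rintro rfl
      simp at hβe
      exact hβ hβe
    have : eval e (Polynomial.X ^ 3 + Polynomial.C e * Polynomial.X ^ 2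
        + Polynomial.C (e ^ 2 + α) * Polynomial.X + Polynomial.C (e * (e ^ 2 + α)))
        = 2 * e * r := by
      simp
      linear_combination 2 * e * he'
    rw [this]
    exact mul_ne_zero (mul_ne_zero h2 he0) hr0

theorem eq_zero_of_sq_eq_mul_sq {k : Type*} [Field k] {Q P A B : k[X]} {e : k}
    (hQ : Q = (Polynomial.X - Polynomial.C e) * P) (hP : P.eval e ≠ 0) (h : A ^ 2 = Q * B ^ 2) :
    A = 0 ∧ B = 0 := by
  by_cases hB : B = 0
  · subst hB
    simpa using h
  have hP0 : P ≠ 0 := by rintro rfl; simp at hP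
  have hQ0 : Q ≠ 0 := by rw [hQ]; exact mul_ne_zero (X_sub_C_ne_zero e) hP0
  have hQB : Q * B ^ 2 ≠ 0 := mul_ne_zero hQ0 (pow_ne_zero 2 hB)
  have hA : A ≠ 0 := by
    rintro rfl
    exact hQB (by simpa using h.symm)
  have key := congrArg (rootMultiplicity e) h
  have hQm : rootMultiplicity e Q = 1 := by
    rw [hQ, rootMultiplicity_mul (hQ ▸ hQ0), rootMultiplicity_X_sub_C_self,
      rootMultiplicity_eq_zero hP]
  rw [rootMultiplicity_mul hQB, hQm, sq, sq, rootMultiplicity_mul (mul_ne_zero hA hA),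
    rootMultiplicity_mul (mul_ne_zero hB hB)] at key
  omega

variable {k : Type*} [Field k] {α β : k}

/-- The pole order at infinity of an element of the double cover is at most `e`. -/
def PoleLE (g : DoubleCover α β) (e : ℕ) : Prop :=
  g.re.natDegree ≤ e ∧ (g.im = 0 ∨ g.im.natDegree + 2 ≤ e)

theorem PoleLE.mono {g : DoubleCover α β} {e e' : ℕ} (h : PoleLE g e) (he : e ≤ e') :
    PoleLE g e' :=
  ⟨h.1.trans he, h.2.imp id fun h => h.trans he⟩

theorem PoleLE.add {g g' : DoubleCover α β} {e : ℕ} (h : PoleLE g e) (h' : PoleLE g' e) :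
    PoleLE (g + g') e := by
  refine ⟨natDegree_add_le_of_degree_le h.1 h'.1, ?_⟩
  have := natDegree_add_le g.im g'.im
  rcases h.2 with h | h <;> rcases h'.2 with h' | h' <;>
    simp only [QuadraticAlgebra.im_add, h, h', add_zero, zero_add, true_or, or_true]
  right
  omega

theorem PoleLE.neg {g : DoubleCover α β} {e : ℕ} (h : PoleLE g e) : PoleLE (-g) e := by
  simpa [PoleLE] using h

theorem PoleLE.mul {g g' : DoubleCover α β} {e e' : ℕ} (h : PoleLE g e) (h' : PoleLE g' e') :
    PoleLE (g * g') (e + e') := by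
  have h1 := natDegree_mul_le_of_le h.1 h'.1
  constructor
  · rw [QuadraticAlgebra.re_mul]
    refine natDegree_add_le_of_degree_le h1 ?_
    rcases h.2 with h2 | h2
    · simp [h2]
    rcases h'.2 with h3 | h3
    · simp [h3]
    have := natDegree_mul_le_of_le
      (natDegree_mul_le_of_le (natDegree_evenQuartic α β).le (le_refl g.im.natDegree))
      (le_refl g'.im.natDegree)
    omega
  · rw [QuadraticAlgebra.im_mul]
    rw [zero_mul, zero_mul, add_zero]
    rcases h.2 with h2 | h2
    · rcases h'.2 with h3 | h3
      · simp [h2, h3]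
      · right
        have := natDegree_mul_le_of_le h.1 (le_refl g'.im.natDegree)
        simp only [h2, zero_mul, add_zero]
        omega
    · rcases h'.2 with h3 | h3
      · right
        have := natDegree_mul_le_of_le (le_refl g.im.natDegree) h'.1
        simp only [h3, mul_zero, zero_add]
        omega
      · right
        have := natDegree_add_le_of_degree_le
          ((natDegree_mul_le_of_le h.1 (le_refl g'.im.natDegree)).trans
            (show _ ≤ e + e' - 2 by omega))
          ((natDegree_mul_le_of_le (le_refl g.im.natDegree) h'.1).trans
            (show _ ≤ e + e' - 2 by omega))
        omega

theorem PoleLE.algebraMap {P : k[X]} {e : ℕ} (h : P.natDegree ≤ e) :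
    PoleLE (algebraMap k[X] (DoubleCover α β) P) e :=
  ⟨h, Or.inl rfl⟩

theorem PoleLE.pow {g : DoubleCover α β} {e : ℕ} (h : PoleLE g e) (m : ℕ) :
    PoleLE (g ^ m) (m * e) := by
  induction m with
  | zero => simpa using PoleLE.algebraMap (α := α) (β := β) (P := 1) (e := 0) (by simp)
  | succ m ih => rw [pow_succ, add_mul, one_mul]; exact ih.mul h

theorem PoleLE.natDegree_norm_le {g : DoubleCover α β} {e : ℕ} (h : PoleLE g e) :
    g.norm.natDegree ≤ 2 * e := by
  have h1 : PoleLE (star g) e := by simpa [PoleLE, QuadraticAlgebra.re_star] using h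
  have h2 := (h.mul h1).1
  rw [← QuadraticAlgebra.algebraMap_norm_eq_mul_star] at h2
  rw [two_mul]
  exact h2

local notation "ι" => algebraMap k[X] (DoubleCover α β)

theorem star_algebraMap_doubleCover (P : k[X]) : star (ι P) = ι P := by
  ext <;> simp [QuadraticAlgebra.algebraMap_eq]

theorem omega_sq_doubleCover : (ω : DoubleCover α β) ^ 2 = ι (evenQuartic α β) := by
  rw [sq, QuadraticAlgebra.omega_mul_omega_eq_mk]; rfl

theorem star_omega_doubleCover : star (ω : DoubleCover α β) = -ω := by
  ext <;> simp

theorem algebraMap_dvd_algebraMap {P R : k[X]} (h : ι P ∣ ι R) : P ∣ R := by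
  obtain ⟨c, hc⟩ := h
  refine ⟨c.re, ?_⟩
  have := congrArg QuadraticAlgebra.re hc
  simpa [QuadraticAlgebra.algebraMap_eq] using this

theorem poleLE_omega : PoleLE (ω : DoubleCover α β) 2 := ⟨by simp, Or.inr (by simp)⟩

theorem eq_zero_of_norm_eq_zero [IsAlgClosed k] (h2 : (2 : k) ≠ 0) (hβ : β ≠ 0)
    (hαβ : α ^ 2 ≠ 4 * β) {g : DoubleCover α β} (h : g.norm = 0) : g = 0 := by
  obtain ⟨e, P, hQ, hP⟩ := exists_simple_root_evenQuartic h2 hβ hαβ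
  have := eq_zero_of_sq_eq_mul_sq (A := g.re) (B := g.im) hQ hP (by
    rw [QuadraticAlgebra.norm_def] at h
    linear_combination h)
  ext
  · rw [this.1]; rfl
  · rw [this.2]; rfl

instance (p : ℕ) [Fact p.Prime] [CharP k p] : CharP (DoubleCover α β) p :=
  (RingHom.charP_iff (algebraMap k[X] (DoubleCover α β))
    (fun _ _ h => congrArg QuadraticAlgebra.re h) p).1 inferInstance

theorem pow_dvd_pairing_mul_conj {A : Type*} [CommRing A] (q : ℕ) {s D a t : A}
    (h : t ^ 2 = s ^ 4 + a * s ^ 2 + D ^ 2) (u v u' v' : A) :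
    s ^ q ∣ (u * s ^ q + v * (t - D) ^ q) * (u' * s ^ q + v' * (-t - D) ^ q) := by
  have h3 : (t - D) ^ q * (-t - D) ^ q = s ^ q * (-(s * (s ^ 2 + a))) ^ q := by
    rw [← mul_pow, ← mul_pow]
    congr 1
    linear_combination -h
  refine ⟨u * (u' * s ^ q + v' * (-t - D) ^ q) + v * (t - D) ^ q * u'
    + v * v' * (-(s * (s ^ 2 + a))) ^ q, ?_⟩
  linear_combination v * v' * h3

theorem mul_pairing {A : Type*} [CommRing A] (p : ℕ) [Fact p.Prime] [CharP A p] (n : ℕ)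
    {s D t u v w : A} (h : u * (s ^ 2) ^ p ^ n + v * (s * t) ^ p ^ n + w = 0) :
    (s * t) ^ p ^ n * (u * s ^ p ^ n + v * (t - D) ^ p ^ n)
      = u * (D ^ p ^ n * s ^ (2 * p ^ n)) + -((t - D) ^ p ^ n * w) := by
  have h4 : (s * t) ^ p ^ n - ((t - D) * s) ^ p ^ n = (D * s) ^ p ^ n := by
    rw [← sub_pow_char_pow]
    congr 1
    ring
  rw [mul_pow, mul_pow] at h4
  have h5 : (s * t) ^ p ^ n * v = -(u * (s ^ 2) ^ p ^ n + w) := by linear_combination h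
  linear_combination (u * s ^ p ^ n) * h4 + (t - D) ^ p ^ n * h5

/-- Pairing a syzygy of low degree with the pencil of syzygies through the point `(0, δ)` of the
double cover gives zero. -/
theorem pairing_eq_zero [IsAlgClosed k] (p : ℕ) [Fact p.Prime] [CharP k p]
    (h2 : (2 : k) ≠ 0) (hβ : β ≠ 0) (hαβ : α ^ 2 ≠ 4 * β) (n d : ℕ) (hd : 2 * d < p ^ n)
    {u v w : DoubleCover α β} (hu : PoleLE u (3 * d)) (hw : PoleLE w (3 * d))
    (h : u * (ι Polynomial.X ^ 2) ^ p ^ n + v * (ι Polynomial.X * ω) ^ p ^ n + w = 0)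
    (δ : k) (hδ : δ ^ 2 = β) :
    u * ι Polynomial.X ^ p ^ n + v * (ω - ι (Polynomial.C δ)) ^ p ^ n = 0 := by
  set q := p ^ n with hq
  set s : DoubleCover α β := ι Polynomial.X with hs
  set D : DoubleCover α β := ι (Polynomial.C δ) with hD
  set g := u * s ^ q + v * (ω - D) ^ q with hg
  have hstar_s : star s = s := star_algebraMap_doubleCover _
  have hstar_D : star D = D := star_algebraMap_doubleCover _
  have hω : (ω : DoubleCover α β) ^ 2 = s ^ 4 + ι (Polynomial.C α) * s ^ 2 + D ^ 2 := by
    have hQ : evenQuartic α β = Polynomial.X ^ 4 + Polynomial.C α * Polynomial.X ^ 2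
        + Polynomial.C δ ^ 2 := by rw [← map_pow, hδ]; rfl
    rw [omega_sq_doubleCover, congrArg ι hQ, map_add, map_add, map_mul, map_pow, map_pow, map_pow]
  by_contra hg0
  have hN0 : g.norm ≠ 0 := fun h => hg0 (eq_zero_of_norm_eq_zero h2 hβ hαβ h)
  -- the norm is divisible by `X ^ q`
  have hdvd : Polynomial.X ^ q ∣ g.norm := by
    apply algebraMap_dvd_algebraMap (α := α) (β := β)
    rw [QuadraticAlgebra.algebraMap_norm_eq_mul_star, map_pow, ← hs]
    have h1 : star g = star u * s ^ q + star v * (-ω - D) ^ q := by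
      simp only [hg, star_add, star_mul', star_pow, star_sub, hstar_s, hstar_D,
        star_omega_doubleCover]
    rw [h1, hg]
    exact pow_dvd_pairing_mul_conj q hω u v (star u) (star v)
  have hdeg1 : q ≤ g.norm.natDegree := by
    simpa using natDegree_le_of_dvd hdvd hN0
  -- the product of `g` with `y ^ q` has small poles
  have hmul : (s * ω) ^ q * g = u * (D ^ q * s ^ (2 * q)) + -((ω - D) ^ q * w) :=
    mul_pairing p n h
  have hpole : PoleLE ((s * ω) ^ q * g) (3 * d + 2 * q) := by
    rw [hmul]
    have hs1 : PoleLE s 1 := PoleLE.algebraMap (by simp)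
    have hD1 : PoleLE D 0 := PoleLE.algebraMap (by simp)
    have ha : PoleLE (ω - D) 2 := by
      rw [sub_eq_add_neg]; exact poleLE_omega.add (hD1.neg.mono (by omega))
    refine ((hu.mul ((hD1.pow q).mul (hs1.pow (2 * q)))).mono (by omega)).add ?_
    exact (((ha.pow q).mul hw).neg).mono (by omega)
  have hNy : (s * ω).norm = -(Polynomial.X ^ 2 * evenQuartic α β) := by
    rw [map_mul, hs, QuadraticAlgebra.norm_algebraMap, QuadraticAlgebra.norm_def]
    simp
  have hQ0 : evenQuartic α β ≠ 0 := by
    intro h0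
    have := natDegree_evenQuartic α β
    simp [h0] at this
  have hNy0 : (s * ω).norm ≠ 0 := by
    rw [hNy]
    exact neg_ne_zero.2 (mul_ne_zero (pow_ne_zero _ Polynomial.X_ne_zero) hQ0)
  have hNydeg : (s * ω).norm.natDegree = 6 := by
    rw [hNy, natDegree_neg, natDegree_mul (pow_ne_zero _ Polynomial.X_ne_zero) hQ0,
      natDegree_evenQuartic, natDegree_X_pow]
  have hdeg2 := hpole.natDegree_norm_le
  rw [map_mul, map_pow, natDegree_mul (pow_ne_zero _ hNy0) hN0, natDegree_pow, hNydeg] at hdeg2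
  omega

theorem syzygy_doubleCover_eq_zero [IsAlgClosed k] (p : ℕ) [Fact p.Prime] [CharP k p]
    (h2 : (2 : k) ≠ 0) (hβ : β ≠ 0) (hαβ : α ^ 2 ≠ 4 * β) (n d : ℕ) (hd : 2 * d < p ^ n)
    {u v w : DoubleCover α β} (hu : PoleLE u (3 * d)) (hw : PoleLE w (3 * d))
    (h : u * (ι Polynomial.X ^ 2) ^ p ^ n + v * (ι Polynomial.X * ω) ^ p ^ n + w = 0) :
    u = 0 ∧ v = 0 ∧ w = 0 := by
  obtain ⟨δ, hδ⟩ := IsAlgClosed.exists_pow_nat_eq β (n := 2) (by norm_num)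
  have e1 := pairing_eq_zero p h2 hβ hαβ n d hd hu hw h δ hδ
  have e2 := pairing_eq_zero p h2 hβ hαβ n d hd hu hw h (-δ) (by rw [neg_sq, hδ])
  have cancel {P : k[X]} (hP : P ≠ 0) {z : DoubleCover α β} (hz : z * ι P = 0) : z = 0 := by
    have hre := congrArg QuadraticAlgebra.re hz
    have him := congrArg QuadraticAlgebra.im hz
    simp [QuadraticAlgebra.algebraMap_eq, hP] at hre him
    ext
    · rw [hre]; rfl
    · rw [him]; rfl
  have hδ0 : 2 * δ ≠ 0 := by
    refine mul_ne_zero h2 ?_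
    rintro rfl
    exact hβ (by simpa using hδ.symm)
  have hv : v = 0 := by
    refine cancel (P := Polynomial.C (2 * δ) ^ p ^ n) (pow_ne_zero _ (by simpa using hδ0)) ?_
    have h3 : ((ω : DoubleCover α β) - ι (Polynomial.C (-δ))) ^ p ^ n
        - (ω - ι (Polynomial.C δ)) ^ p ^ n = ι (Polynomial.C (2 * δ) ^ p ^ n) := by
      rw [← sub_pow_char_pow, map_pow]
      congr 1
      simp only [map_neg, map_mul, map_ofNat]
      ring
    linear_combination e2 - e1 - v * h3
  have hu0 : u = 0 := by
    refine cancel (P := Polynomial.X ^ p ^ n) (pow_ne_zero _ Polynomial.X_ne_zero) ?_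
    rw [map_pow]
    simpa [hv] using e1
  exact ⟨hu0, hv, by simpa [hu0, hv] using h⟩

end quartic

section weierstrass
open QuadraticAlgebra

variable {k : Type*} [Field k] {α β : k}

/-- The affine cubic `y² = x (x² + α x + β)`. -/
noncomputable def affineCubic (α β : k) : MvPolynomial (Fin 2) k :=
  X 1 ^ 2 - X 0 * (X 0 ^ 2 + C α * X 0 + C β)

/-- The double cover `(s, t) ↦ (s², s t)` of the affine cubic, on coordinate rings. -/
noncomputable def toDoubleCover (α β : k) : MvPolynomial (Fin 2) k →ₐ[k] DoubleCover α β :=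
  aeval ![algebraMap (Polynomial k) _ Polynomial.X ^ 2,
    algebraMap (Polynomial k) _ Polynomial.X * ω]

theorem toDoubleCover_X_zero :
    toDoubleCover α β (X 0) = algebraMap (Polynomial k) _ Polynomial.X ^ 2 := by
  simp [toDoubleCover]

theorem toDoubleCover_X_one :
    toDoubleCover α β (X 1) = algebraMap (Polynomial k) _ Polynomial.X * ω := by
  simp [toDoubleCover]

theorem toDoubleCover_aeval (P : Polynomial k) :
    toDoubleCover α β (Polynomial.aeval (X 0) P)
      = algebraMap (Polynomial k) _ (P.comp (Polynomial.X ^ 2)) := by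
  rw [← Polynomial.aeval_algHom_apply, toDoubleCover_X_zero, ← map_pow,
    Polynomial.aeval_algebraMap_apply, Polynomial.comp_eq_aeval]

theorem toDoubleCover_affineCubic : toDoubleCover α β (affineCubic α β) = 0 := by
  have h (c : k) : toDoubleCover α β (C c) = algebraMap (Polynomial k) _ (Polynomial.C c) := by
    have := toDoubleCover_aeval (α := α) (β := β) (Polynomial.C c)
    simpa using this
  simp only [affineCubic, map_sub, map_mul, map_add, map_pow, toDoubleCover_X_zero,
    toDoubleCover_X_one, h]
  rw [mul_pow, omega_sq_doubleCover]
  simp only [← map_pow, ← map_mul, ← map_add, ← map_sub]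
  rw [← map_zero (algebraMap (Polynomial k) (DoubleCover α β))]
  congr 1
  rw [evenQuartic]
  ring

theorem exists_affineCubic_dvd_sub (h : MvPolynomial (Fin 2) k) : ∃ P R : Polynomial k,
    affineCubic α β ∣ h - (Polynomial.aeval (X 0) P + Polynomial.aeval (X 0) R * X 1) := by
  induction h using MvPolynomial.induction_on with
  | C a => exact ⟨Polynomial.C a, 0, by simp⟩
  | add f g hf hg =>
    obtain ⟨P, R, c, hc⟩ := hf
    obtain ⟨P', R', c', hc'⟩ := hg
    refine ⟨P + P', R + R', c + c', ?_⟩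
    simp only [map_add]
    linear_combination hc + hc'
  | mul_X f i hf =>
    obtain ⟨P, R, c, hc⟩ := hf
    have hi : i = 0 ∨ i = 1 := by fin_cases i <;> simp
    rcases hi with rfl | rfl
    · refine ⟨P * Polynomial.X, R * Polynomial.X, c * X 0, ?_⟩
      simp only [map_mul, Polynomial.aeval_X]
      linear_combination X 0 * hc
    · refine ⟨R * (Polynomial.X * (Polynomial.X ^ 2 + Polynomial.C α * Polynomial.X
        + Polynomial.C β)), P, c * X 1 + Polynomial.aeval (X 0) R, ?_⟩
      simp only [map_mul, map_add, map_pow, Polynomial.aeval_X, Polynomial.aeval_C, affineCubic,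
        algebraMap_eq] at hc ⊢
      linear_combination X 1 * hc

theorem affineCubic_dvd_of_toDoubleCover_eq_zero {h : MvPolynomial (Fin 2) k}
    (hh : toDoubleCover α β h = 0) : affineCubic α β ∣ h := by
  obtain ⟨P, R, hPR⟩ := exists_affineCubic_dvd_sub (α := α) (β := β) h
  have h0 : toDoubleCover α β
      (Polynomial.aeval (X 0) P + Polynomial.aeval (X 0) R * X 1) = 0 := by
    obtain ⟨c, hc⟩ := hPR
    have := congrArg (toDoubleCover α β) hc
    rw [map_mul, toDoubleCover_affineCubic, zero_mul, map_sub, hh, zero_sub, neg_eq_zero] at this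
    exact this
  rw [map_add, map_mul, toDoubleCover_aeval, toDoubleCover_aeval, toDoubleCover_X_one] at h0
  have hre := congrArg QuadraticAlgebra.re h0
  have him := congrArg QuadraticAlgebra.im h0
  have hinj {T : Polynomial k} (hT : T.comp (Polynomial.X ^ 2) = 0) : T = 0 := by
    rw [← Polynomial.expand_eq_comp_X_pow] at hT
    exact (Polynomial.expand_eq_zero (by norm_num)).1 hT
  simp [QuadraticAlgebra.algebraMap_eq] at hre him
  rw [hinj hre, hinj him] at hPR
  simpa using hPR

theorem poleLE_toDoubleCover {h : MvPolynomial (Fin 2) k} {d : ℕ} (hd : h.totalDegree ≤ d) :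
    PoleLE (toDoubleCover α β h) (3 * d) := by
  have hsum (s : Finset (Fin 2 →₀ ℕ)) (c : (Fin 2 →₀ ℕ) → DoubleCover α β) (e : ℕ)
      (hc : ∀ m ∈ s, PoleLE (c m) e) : PoleLE (∑ m ∈ s, c m) e := by
    classical
    induction s using Finset.induction_on with
    | empty => simp [PoleLE]
    | insert a s ha ih =>
      rw [Finset.sum_insert ha]
      exact (hc a (by simp)).add (ih fun m hm => hc m (by simp [hm]))
  have hs : PoleLE (algebraMap (Polynomial k) (DoubleCover α β) Polynomial.X) 1 :=
    PoleLE.algebraMap (by simp)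
  rw [h.as_sum, map_sum]
  refine hsum _ _ _ fun m hm => ?_
  have hm' := (le_totalDegree hm).trans hd
  rw [Finsupp.sum_fintype _ _ (by simp), Fin.sum_univ_two] at hm'
  rw [monomial_eq, Finsupp.prod_fintype _ _ (by simp), Fin.prod_univ_two, map_mul, map_mul,
    map_pow, map_pow, toDoubleCover_X_zero, toDoubleCover_X_one]
  have hC : PoleLE (toDoubleCover α β (C (coeff m h))) 0 := by
    have := toDoubleCover_aeval (α := α) (β := β) (Polynomial.C (coeff m h))
    rw [Polynomial.aeval_C, algebraMap_eq] at this
    rw [this]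
    exact PoleLE.algebraMap (by simp)
  exact (hC.mul (((hs.pow 2).pow (m 0)).mul ((hs.mul poleLE_omega).pow (m 1)))).mono (by omega)

theorem affineCubic_no_low_degree_syzygy [IsAlgClosed k] (p : ℕ) [Fact p.Prime] [CharP k p]
    (h2 : (2 : k) ≠ 0) (hβ : β ≠ 0) (hαβ : α ^ 2 ≠ 4 * β) (n d : ℕ) (hd : 2 * d < p ^ n)
    {u v w : MvPolynomial (Fin 2) k} (hu : u.totalDegree ≤ d) (hw : w.totalDegree ≤ d)
    (h : affineCubic α β ∣ u * X 0 ^ p ^ n + v * X 1 ^ p ^ n + w) :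
    affineCubic α β ∣ u ∧ affineCubic α β ∣ v ∧ affineCubic α β ∣ w := by
  obtain ⟨c, hc⟩ := h
  have h0 := congrArg (toDoubleCover α β) hc
  rw [map_mul, toDoubleCover_affineCubic, zero_mul] at h0
  simp only [map_add, map_mul, map_pow, toDoubleCover_X_zero, toDoubleCover_X_one] at h0
  obtain ⟨h1, h3, h4⟩ := syzygy_doubleCover_eq_zero p h2 hβ hαβ n d hd
    (poleLE_toDoubleCover hu) (poleLE_toDoubleCover hw) h0
  exact ⟨affineCubic_dvd_of_toDoubleCover_eq_zero h1,
    affineCubic_dvd_of_toDoubleCover_eq_zero h3, affineCubic_dvd_of_toDoubleCover_eq_zero h4⟩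

end weierstrass

section dehomogenization

variable {k : Type*} [Field k]

/-- Specialization of a polynomial in `x, y, z` at `z = 1`. -/
noncomputable def dehomogenize : MvPolynomial (Fin 3) k →ₐ[k] MvPolynomial (Fin 2) k :=
  aeval ![X 0, X 1, 1]

theorem dehomogenize_X_zero : dehomogenize (X 0 : MvPolynomial (Fin 3) k) = X 0 := by
  simp [dehomogenize]

theorem dehomogenize_X_one : dehomogenize (X 1 : MvPolynomial (Fin 3) k) = X 1 := by
  simp [dehomogenize]

theorem dehomogenize_X_two : dehomogenize (X 2 : MvPolynomial (Fin 3) k) = 1 := by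
  simp [dehomogenize]

theorem dehomogenize_C (c : k) : dehomogenize (C c : MvPolynomial (Fin 3) k) = C c := by
  simp [dehomogenize]

theorem totalDegree_dehomogenize_le {P : MvPolynomial (Fin 3) k} {e r : ℕ}
    (hP : P.IsHomogeneous e) (hr : ∀ m ∈ P.support, r ≤ m 2) :
    (dehomogenize P).totalDegree ≤ e - r := by
  rw [P.as_sum, map_sum]
  refine totalDegree_finsetSum_le fun m hm => ?_
  have h1 := hP.degree_eq_sum_deg_support hm
  have h2 := hr m hm
  rw [← Finsupp.degree_apply, Finsupp.degree_eq_sum, Fin.sum_univ_three] at h1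
  rw [monomial_eq, Finsupp.prod_fintype _ _ (by simp), Fin.prod_univ_three]
  simp only [map_mul, map_pow, dehomogenize_X_zero, dehomogenize_X_one, dehomogenize_X_two,
    dehomogenize_C, one_pow, mul_one]
  calc _ ≤ 0 + (m 0 + m 1) := (totalDegree_mul _ _).trans
        (add_le_add (totalDegree_C _).le ((totalDegree_mul _ _).trans
          (add_le_add (totalDegree_X_pow _ _).le (totalDegree_X_pow _ _).le)))
    _ ≤ e - r := by omega

theorem not_X_two_dvd_of_totalDegree_dehomogenize {F : MvPolynomial (Fin 3) k} {e : ℕ}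
    (hF : F.IsHomogeneous (e + 1)) (h : (dehomogenize F).totalDegree = e + 1) : ¬ X 2 ∣ F := by
  rintro ⟨G, hG⟩
  have := totalDegree_dehomogenize_le (r := 1) hF fun m hm => by
    rw [hG, mem_support_iff, coeff_X_mul'] at hm
    have : (2 : Fin 3) ∈ m.support := by
      by_contra h
      simp [h] at hm
    rw [Finsupp.mem_support_iff] at this
    omega
  omega

theorem exists_isHomogeneous_dehomogenize_eq {c : MvPolynomial (Fin 2) k} {N : ℕ}
    (hc : c.totalDegree ≤ N) :
    ∃ P : MvPolynomial (Fin 3) k, P.IsHomogeneous N ∧ dehomogenize P = c := by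
  refine ⟨∑ m ∈ c.support, C (coeff m c) * (X 0 ^ m 0 * X 1 ^ m 1 * X 2 ^ (N - m 0 - m 1)),
    IsHomogeneous.sum _ _ _ fun m hm => ?_, ?_⟩
  · have hm' := (le_totalDegree hm).trans hc
    rw [Finsupp.sum_fintype _ _ (by simp), Fin.sum_univ_two] at hm'
    have h := (((isHomogeneous_X_pow (R := k) (0 : Fin 3) (m 0)).mul
      (isHomogeneous_X_pow 1 (m 1))).mul (isHomogeneous_X_pow 2 (N - m 0 - m 1))).C_mul (coeff m c)
    convert h using 1
    omega
  · conv_rhs => rw [c.as_sum]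
    rw [map_sum]
    refine Finset.sum_congr rfl fun m _ => ?_
    rw [monomial_eq, Finsupp.prod_fintype _ _ (by simp), Fin.prod_univ_two]
    simp only [map_mul, map_pow, dehomogenize_X_zero, dehomogenize_X_one, dehomogenize_X_two,
      dehomogenize_C, one_pow, mul_one]

theorem eval_smul_of_isHomogeneous {σ : Type*} {P : MvPolynomial σ k} {e : ℕ}
    (hP : P.IsHomogeneous e) (c : k) (a : σ → k) : eval (c • a) P = c ^ e * eval a P := by
  rw [eval_eq, eval_eq, Finset.mul_sum]
  refine Finset.sum_congr rfl fun m hm => ?_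
  have h1 := hP.degree_eq_sum_deg_support hm
  simp only [Pi.smul_apply, smul_eq_mul, mul_pow, Finset.prod_mul_distrib,
    Finset.prod_pow_eq_pow_sum]
  rw [h1]
  ring

theorem eval_dehomogenize (b : Fin 2 → k) (P : MvPolynomial (Fin 3) k) :
    eval b (dehomogenize P) = eval ![b 0, b 1, 1] P := by
  have : ((aeval b).comp dehomogenize : MvPolynomial (Fin 3) k →ₐ[k] k)
      = aeval ![b 0, b 1, 1] := by
    ext i
    fin_cases i <;> simp [dehomogenize]
  simpa [coe_aeval_eq_eval] using congrArg (fun φ => φ P) this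

theorem eq_zero_of_dehomogenize_eq_zero [Infinite k] {P : MvPolynomial (Fin 3) k} {e : ℕ}
    (hP : P.IsHomogeneous e) (h : dehomogenize P = 0) : P = 0 := by
  have h0 : X 2 * P = 0 := by
    refine MvPolynomial.funext fun a => ?_
    rw [map_mul, eval_X, map_zero]
    by_cases ha : a 2 = 0
    · rw [ha, zero_mul]
    have ha' : a = a 2 • ![a 0 / a 2, a 1 / a 2, 1] := by
      ext i
      fin_cases i <;> simp <;> field_simp
    have h1 := eval_dehomogenize ![a 0 / a 2, a 1 / a 2] P
    rw [h, map_zero] at h1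
    rw [ha', eval_smul_of_isHomogeneous hP]
    simp only [Matrix.cons_val_zero, Matrix.cons_val_one] at h1
    rw [← h1, mul_zero, mul_zero]
  exact (mul_eq_zero.1 h0).resolve_left (X_ne_zero 2)

theorem dvd_of_dehomogenize_dvd [Infinite k] {F H : MvPolynomial (Fin 3) k} {a b : ℕ}
    (hF : F.IsHomogeneous a) (hH : H.IsHomogeneous b) (hXF : ¬ X 2 ∣ F)
    (h : dehomogenize F ∣ dehomogenize H) : F ∣ H := by
  obtain ⟨c, hc⟩ := h
  obtain ⟨G, hG, rfl⟩ := exists_isHomogeneous_dehomogenize_eq (le_refl c.totalDegree)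
  set N := (dehomogenize G).totalDegree
  have h1 : X 2 ^ (a + N) * H = F * (X 2 ^ b * G) := by
    refine sub_eq_zero.1 (eq_zero_of_dehomogenize_eq_zero (e := a + N + b) ?_ ?_)
    · refine ((isHomogeneous_X_pow 2 _).mul hH).sub ?_
      have h := hF.mul ((isHomogeneous_X_pow (R := k) 2 b).mul hG)
      rwa [show a + (b + N) = a + N + b by ring] at h
    · simp only [map_sub, map_mul, map_pow, dehomogenize_X_two, hc]
      ring
  obtain ⟨D, hD⟩ := X_prime.pow_dvd_of_dvd_mul_left (a + N) hXF (Dvd.intro _ h1)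
  refine ⟨D, mul_left_cancel₀ (pow_ne_zero (a + N) (X_ne_zero (R := k) (2 : Fin 3))) ?_⟩
  rw [h1, hD]
  ring

end dehomogenization

section linearSubstitution

variable {k : Type*} [Field k]

/-- The linear substitution of variables with matrix `M`. -/
noncomputable def linearSubst {ι : Type*} [Fintype ι] (M : Matrix ι ι k) :
    MvPolynomial ι k →ₐ[k] MvPolynomial ι k :=
  aeval fun i => ∑ j, C (M i j) * X j

variable {ι : Type*} [Fintype ι]

theorem linearSubst_X (M : Matrix ι ι k) (i : ι) :
    linearSubst M (X i) = ∑ j, C (M i j) * X j := by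
  simp [linearSubst]

theorem linearSubst_linearSubst (M N : Matrix ι ι k) (P : MvPolynomial ι k) :
    linearSubst N (linearSubst M P) = linearSubst (M * N) P := by
  have : (linearSubst N).comp (linearSubst M) = linearSubst (M * N) := by
    refine algHom_ext fun i => ?_
    simp only [AlgHom.comp_apply, linearSubst_X, map_sum, map_mul, Matrix.mul_apply,
      Finset.mul_sum, Finset.sum_mul, ← algebraMap_eq, AlgHom.commutes]
    rw [Finset.sum_comm]
    simp only [mul_assoc]
  exact congrArg (fun φ => φ P) this

theorem linearSubst_one [DecidableEq ι] (P : MvPolynomial ι k) :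
    linearSubst (1 : Matrix ι ι k) P = P := by
  have : linearSubst (1 : Matrix ι ι k) = AlgHom.id k _ := by
    refine algHom_ext fun i => ?_
    simp [linearSubst_X, Matrix.one_apply]
  rw [this, AlgHom.id_apply]

theorem isHomogeneous_linearSubst {P : MvPolynomial ι k} {d : ℕ} (hP : P.IsHomogeneous d)
    (M : Matrix ι ι k) : (linearSubst M P).IsHomogeneous d := by
  have := hP.aeval (fun i => ∑ j, C (M i j) * X j) (n := 1)
    fun i => IsHomogeneous.sum _ _ _ fun j _ => (isHomogeneous_X k j).C_mul _
  rwa [one_mul] at this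

theorem eval_linearSubst (M : Matrix ι ι k) (a : ι → k) (P : MvPolynomial ι k) :
    eval a (linearSubst M P) = eval (M.mulVec a) P := by
  have : (aeval a).comp (linearSubst M) = (aeval (M.mulVec a) : MvPolynomial ι k →ₐ[k] k) := by
    refine algHom_ext fun i => ?_
    simp [linearSubst_X, Matrix.mulVec, dotProduct]
  simpa [coe_aeval_eq_eval] using congrArg (fun φ => φ P) this

/-- No homogeneous relation of degree less than `q / 2` among the `q`-th powers of the coordinates
holds modulo `F`, other than the trivial ones, for all powers `q` of `p`. -/
def NoLowDegreeSyzygy (p : ℕ) (F : MvPolynomial ι k) : Prop :=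
  ∀ n d : ℕ, 2 * d < p ^ n → ∀ U : ι → MvPolynomial ι k, (∀ i, (U i).IsHomogeneous d) →
    F ∣ ∑ i, U i * X i ^ p ^ n → ∀ i, F ∣ U i

theorem NoLowDegreeSyzygy.of_linearSubst [DecidableEq ι] {p : ℕ} [Fact p.Prime] [CharP k p]
    {F : MvPolynomial ι k} {M : Matrix ι ι k} (hM : IsUnit M.det)
    (h : NoLowDegreeSyzygy p (linearSubst M F)) : NoLowDegreeSyzygy p F := by
  intro n d hd U hU hF i
  set Q : Matrix ι ι k := M.map (iterateFrobenius k p n) with hQdef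
  have hQ : IsUnit Q.det := by
    have := RingHom.map_det (iterateFrobenius k p n) M
    rw [hQdef]
    rw [RingHom.mapMatrix_apply] at this
    rw [← this]
    exact hM.map _
  have hX (l : ι) : linearSubst M (X l) ^ p ^ n = ∑ j, C (Q l j) * X j ^ p ^ n := by
    rw [linearSubst_X, sum_pow_char_pow]
    simp only [mul_pow, ← C_pow]
    rfl
  have hV := h n d hd (fun j => ∑ l, C (Q l j) * linearSubst M (U l))
    (fun j => IsHomogeneous.sum _ _ _ fun l _ => (isHomogeneous_linearSubst (hU l) M).C_mul _) (by
      have h0 := map_dvd (linearSubst M) hF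
      simp only [map_sum, map_mul, map_pow, hX, Finset.mul_sum] at h0
      rw [Finset.sum_comm] at h0
      convert h0 using 2 with j
      rw [Finset.sum_mul]
      refine Finset.sum_congr rfl fun l _ => ?_
      ring)
  have hUi : linearSubst M (U i)
      = ∑ j, C (Q⁻¹ j i) * ∑ l, C (Q l j) * linearSubst M (U l) := by
    simp only [Finset.mul_sum]
    rw [Finset.sum_comm]
    have h1 (l : ι) : ∑ j, C (Q⁻¹ j i) * (C (Q l j) * linearSubst M (U l))
        = C ((1 : Matrix ι ι k) l i) * linearSubst M (U l) := by
      rw [← Matrix.mul_nonsing_inv Q hQ, Matrix.mul_apply, map_sum, Finset.sum_mul]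
      refine Finset.sum_congr rfl fun j _ => ?_
      rw [C_mul]
      ring
    simp [h1, Matrix.one_apply]
  have hdvd : linearSubst M F ∣ linearSubst M (U i) := by
    rw [hUi]
    exact Finset.dvd_sum fun j _ => (hV j).mul_left _
  have := map_dvd (linearSubst M⁻¹) hdvd
  simpa only [linearSubst_linearSubst, Matrix.mul_nonsing_inv M hM, linearSubst_one] using this

theorem NoLowDegreeSyzygy.C_mul {p : ℕ} {F : MvPolynomial ι k} (h : NoLowDegreeSyzygy p F)
    {c : k} (hc : c ≠ 0) : NoLowDegreeSyzygy p (C c * F) := by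
  intro n d hd U hU hF
  have hu : IsUnit (C c : MvPolynomial ι k) := (isUnit_iff_ne_zero.2 hc).map C
  simp only [hu.mul_left_dvd] at hF ⊢
  exact h n d hd U hU hF

/-- The projective cubic `y² z = x (x² + α x z + β z²)`. -/
noncomputable def projectiveCubic (α β : k) : MvPolynomial (Fin 3) k :=
  X 1 ^ 2 * X 2 - X 0 * (X 0 ^ 2 + C α * X 0 * X 2 + C β * X 2 ^ 2)

theorem isHomogeneous_projectiveCubic (α β : k) : (projectiveCubic α β).IsHomogeneous 3 := by
  have hX (i : Fin 3) := isHomogeneous_X k i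
  have h : (X 0 ^ 2 + C α * X 0 * X 2 + C β * X 2 ^ 2 : MvPolynomial (Fin 3) k).IsHomogeneous 2 :=
    (((hX 0).pow 2).add (((hX 0).C_mul α).mul (hX 2))).add (((hX 2).pow 2).C_mul β)
  exact (((hX 1).pow 2).mul (hX 2)).sub ((hX 0).mul h)

theorem dehomogenize_projectiveCubic (α β : k) :
    dehomogenize (projectiveCubic α β) = affineCubic α β := by
  simp [projectiveCubic, affineCubic, dehomogenize_X_zero, dehomogenize_X_one, dehomogenize_X_two]

theorem noLowDegreeSyzygy_projectiveCubic [IsAlgClosed k] (p : ℕ) [Fact p.Prime] [CharP k p]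
    (h2 : (2 : k) ≠ 0) {α β : k} (hβ : β ≠ 0) (hαβ : α ^ 2 ≠ 4 * β) :
    NoLowDegreeSyzygy p (projectiveCubic α β) := by
  intro n d hd U hU h
  have : Infinite k := IsAlgClosed.instInfinite
  have hX2 : ¬ X 2 ∣ projectiveCubic α β := by
    intro h
    have := map_dvd (eval ![1, 0, 0]) h
    simp [projectiveCubic] at this
  have hdeg (i : Fin 3) : (dehomogenize (U i)).totalDegree ≤ d := by
    simpa using totalDegree_dehomogenize_le (r := 0) (hU i) fun _ _ => Nat.zero_le _
  have h' := map_dvd dehomogenize h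
  simp only [Fin.sum_univ_three, map_add, map_mul, map_pow, dehomogenize_X_zero,
    dehomogenize_X_one, dehomogenize_X_two, one_pow, mul_one, dehomogenize_projectiveCubic] at h'
  obtain ⟨h0, h1, h2⟩ :=
    affineCubic_no_low_degree_syzygy p h2 hβ hαβ n d hd (hdeg 0) (hdeg 2) h'
  intro i
  refine dvd_of_dehomogenize_dvd (isHomogeneous_projectiveCubic α β) (hU i) hX2 ?_
  rw [dehomogenize_projectiveCubic]
  fin_cases i <;> assumption

end linearSubstitution

theorem exists_ne_zero_common_zero {k : Type*} [Field k] [IsAlgClosed k]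
    (F G : MvPolynomial (Fin 3) k) (hF : eval 0 F = 0) (hG : eval 0 G = 0) :
    ∃ a : Fin 3 → k, a ≠ 0 ∧ eval a F = 0 ∧ eval a G = 0 := by
  classical
  by_contra! hcon
  have hdim : ringKrullDim (MvPolynomial (Fin 3) k) = 3 := by simp
  have : FiniteRingKrullDim (MvPolynomial (Fin 3) k) := by
    rw [finiteRingKrullDim_iff_ne_bot_and_top, hdim]
    exact ⟨by decide, by decide⟩
  obtain ⟨M, hM, hht⟩ := Ideal.exists_isMaximal_height (R := MvPolynomial (Fin 3) k)
  obtain ⟨x, rfl⟩ := (isMaximal_iff_eq_vanishingIdeal_singleton (K := k)).1 hM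
  let τ : MvPolynomial (Fin 3) k →ₐ[k] MvPolynomial (Fin 3) k := aeval fun i => X i - C (x i)
  have hτ (a : Fin 3 → k) (P : MvPolynomial (Fin 3) k) : aeval a (τ P) = eval (a - x) P := by
    change ((aeval a).comp τ) P = aeval (a - x) P
    congr 1
    ext i
    simp [τ]
  let s : Finset (MvPolynomial (Fin 3) k) := {τ F, τ G}
  have hrad : (Ideal.span (s : Set (MvPolynomial (Fin 3) k))).radical = vanishingIdeal k {x} := by
    rw [← vanishingIdeal_zeroLocus_eq_radical (K := k), zeroLocus_span]
    congr 1
    ext a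
    constructor
    · intro ha
      have h1 := ha (τ F) (by simp [s])
      have h2 := ha (τ G) (by simp [s])
      rw [hτ] at h1 h2
      by_contra hne
      exact hcon (a - x) (sub_ne_zero.2 hne) h1 h2
    · rintro rfl P hP
      have : P = τ F ∨ P = τ G := by simpa [s] using hP
      rcases this with rfl | rfl <;> simp only [hτ, sub_self, hF, hG]
  have hmin : vanishingIdeal k {x} ∈
      (Ideal.span (s : Set (MvPolynomial (Fin 3) k))).minimalPrimes := by
    rw [← Ideal.radical_minimalPrimes, hrad, Ideal.minimalPrimes_eq_subsingleton_self]
    rfl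
  have h2 : (vanishingIdeal k {x}).height ≤ 2 :=
    (Ideal.height_le_card_of_mem_minimalPrimes_span_finset hmin).trans
      (by exact_mod_cast Finset.card_le_two)
  rw [hdim] at hht
  have h3 : (vanishingIdeal k {x}).height = 3 := WithBot.coe_injective hht
  rw [h3] at h2
  exact absurd h2 (by decide)

section normalForm

variable {k : Type*} [Field k]

/-- The general ternary cubic form. -/
noncomputable def ternaryCubic (c : ℕ → ℕ → k) : MvPolynomial (Fin 3) k :=
  ∑ i ∈ Finset.range 4, ∑ j ∈ Finset.range (4 - i),
    C (c i j) * (X 0 ^ i * X 1 ^ j * X 2 ^ (3 - i - j))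

theorem exists_eq_ternaryCubic {F : MvPolynomial (Fin 3) k} (hF : F.IsHomogeneous 3) :
    ∃ c, F = ternaryCubic c := by
  refine ⟨fun i j => ∑ m ∈ F.support, if i = m 0 ∧ j = m 1 then coeff m F else 0, ?_⟩
  conv_lhs => rw [F.as_sum]
  simp only [ternaryCubic, map_sum, Finset.sum_mul]
  simp_rw [Finset.sum_comm (t := F.support)]
  refine Finset.sum_congr rfl fun m hm => ?_
  have hm' := hF.degree_eq_sum_deg_support hm
  rw [← Finsupp.degree_apply, Finsupp.degree_eq_sum, Fin.sum_univ_three] at hm'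
  rw [Finset.sum_eq_single (m 0), Finset.sum_eq_single (m 1)]
  · rw [monomial_eq, Finsupp.prod_fintype _ _ (by simp), Fin.prod_univ_three,
      show 3 - m 0 - m 1 = m 2 by omega]
    simp
  · intro j _ hj
    simp [hj]
  · intro h
    simp only [Finset.mem_range] at h
    omega
  · intro i _ hi
    simp [hi]
  · intro h
    simp only [Finset.mem_range] at h
    omega

theorem eval_ternaryCubic (c : ℕ → ℕ → k) (a : Fin 3 → k) :
    eval a (ternaryCubic c) = c 3 0 * a 0 ^ 3 + c 0 3 * a 1 ^ 3 + c 0 0 * a 2 ^ 3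
      + c 2 1 * a 0 ^ 2 * a 1 + c 2 0 * a 0 ^ 2 * a 2 + c 1 2 * a 0 * a 1 ^ 2
      + c 0 2 * a 1 ^ 2 * a 2 + c 1 0 * a 0 * a 2 ^ 2 + c 0 1 * a 1 * a 2 ^ 2
      + c 1 1 * a 0 * a 1 * a 2 := by
  simp [ternaryCubic, Finset.sum_range_succ]
  ring

/-- Nonsingularity of a ternary cubic form in odd characteristic, by means of the odd part
`2 (∇F(a) ⬝ v + F(v))` of `v ↦ F(a + v)`. -/
def NonsingularCubic (F : MvPolynomial (Fin 3) k) : Prop :=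
  ∀ a, eval a F = 0 → (∀ v, eval (a + v) F - eval (a - v) F = 2 * eval v F) → a = 0

theorem nonsingularCubic_of_pderiv (h2 : (2 : k) ≠ 0) {F : MvPolynomial (Fin 3) k}
    (hF : F.IsHomogeneous 3)
    (h : ∀ a, eval a F = 0 → (∀ i, eval a (pderiv i F) = 0) → a = 0) : NonsingularCubic F := by
  obtain ⟨c, rfl⟩ := exists_eq_ternaryCubic hF
  intro a ha hv
  refine h a ha fun i => ?_
  have h1 := hv (Pi.single i 1)
  simp only [eval_ternaryCubic] at h1
  fin_cases i <;>
    simp [ternaryCubic, Finset.sum_range_succ, pderiv_X] at h1 ⊢ <;>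
    refine mul_left_cancel₀ h2 ?_ <;> linear_combination h1

theorem NonsingularCubic.linearSubst {F : MvPolynomial (Fin 3) k} (h : NonsingularCubic F)
    {M : Matrix (Fin 3) (Fin 3) k} (hM : IsUnit M.det) : NonsingularCubic (linearSubst M F) := by
  intro a ha hv
  simp only [eval_linearSubst] at ha hv
  have h0 := h _ ha fun v => by
    have := hv (M⁻¹.mulVec v)
    simpa [Matrix.mulVec_add, Matrix.mulVec_sub, Matrix.mul_nonsing_inv M hM] using this
  have := congrArg M⁻¹.mulVec h0
  simpa [Matrix.nonsing_inv_mul M hM] using this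

theorem exists_flex [IsAlgClosed k] (h2 : (2 : k) ≠ 0) {F : MvPolynomial (Fin 3) k}
    (hF : F.IsHomogeneous 3) (hs : NonsingularCubic F) :
    ∃ M : Matrix (Fin 3) (Fin 3) k, IsUnit M.det ∧
      ∀ x y, eval ![x, y, 0] (linearSubst M F) = x ^ 3 * eval ![1, 0, 0] (linearSubst M F) := by
  obtain ⟨c, rfl⟩ := exists_eq_ternaryCubic hF
  let H (P : Fin 3 → k) : Matrix (Fin 3) (Fin 3) k :=
    !![6 * c 3 0 * P 0 + 2 * c 2 1 * P 1 + 2 * c 2 0 * P 2,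
        2 * c 2 1 * P 0 + 2 * c 1 2 * P 1 + c 1 1 * P 2,
        2 * c 2 0 * P 0 + c 1 1 * P 1 + 2 * c 1 0 * P 2;
      2 * c 2 1 * P 0 + 2 * c 1 2 * P 1 + c 1 1 * P 2,
        2 * c 1 2 * P 0 + 6 * c 0 3 * P 1 + 2 * c 0 2 * P 2,
        c 1 1 * P 0 + 2 * c 0 2 * P 1 + 2 * c 0 1 * P 2;
      2 * c 2 0 * P 0 + c 1 1 * P 1 + 2 * c 1 0 * P 2,
        c 1 1 * P 0 + 2 * c 0 2 * P 1 + 2 * c 0 1 * P 2,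
        2 * c 1 0 * P 0 + 2 * c 0 1 * P 1 + 6 * c 0 0 * P 2]
  let A : Matrix (Fin 3) (Fin 3) (MvPolynomial (Fin 3) k) :=
    !![6 * C (c 3 0) * X 0 + 2 * C (c 2 1) * X 1 + 2 * C (c 2 0) * X 2,
        2 * C (c 2 1) * X 0 + 2 * C (c 1 2) * X 1 + C (c 1 1) * X 2,
        2 * C (c 2 0) * X 0 + C (c 1 1) * X 1 + 2 * C (c 1 0) * X 2;
      2 * C (c 2 1) * X 0 + 2 * C (c 1 2) * X 1 + C (c 1 1) * X 2,
        2 * C (c 1 2) * X 0 + 6 * C (c 0 3) * X 1 + 2 * C (c 0 2) * X 2,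
        C (c 1 1) * X 0 + 2 * C (c 0 2) * X 1 + 2 * C (c 0 1) * X 2;
      2 * C (c 2 0) * X 0 + C (c 1 1) * X 1 + 2 * C (c 1 0) * X 2,
        C (c 1 1) * X 0 + 2 * C (c 0 2) * X 1 + 2 * C (c 0 1) * X 2,
        2 * C (c 1 0) * X 0 + 2 * C (c 0 1) * X 1 + 6 * C (c 0 0) * X 2]
  have hA (P : Fin 3 → k) : eval P A.det = (H P).det := by
    simp [A, H, Matrix.det_fin_three]
  obtain ⟨P, hP0, hFP, hHP⟩ := exists_ne_zero_common_zero (ternaryCubic c) A.det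
    (by rw [eval_ternaryCubic]; simp) (by rw [hA]; simp [H, Matrix.det_fin_three])
  rw [hA] at hHP
  obtain ⟨w, hw0, hw⟩ := Matrix.exists_mulVec_eq_zero_iff.2 hHP
  have hrow (i : Fin 3) := congrFun hw i
  have e0 := hrow 0
  have e1 := hrow 1
  have e2 := hrow 2
  simp only [H, Matrix.mulVec, dotProduct, Fin.sum_univ_three, Matrix.of_apply, Matrix.cons_val,
    Pi.zero_apply] at e0 e1 e2
  rw [eval_ternaryCubic] at hFP
  have hcross : crossProduct w P ≠ 0 := by
    rw [crossProduct_ne_zero_iff_linearIndependent, LinearIndependent.pair_iff' hw0]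
    rintro t rfl
    refine hP0 (hs _ (by rw [eval_ternaryCubic, hFP]) fun v => ?_)
    simp only [eval_ternaryCubic, Pi.add_apply, Pi.sub_apply, Pi.smul_apply, smul_eq_mul] at *
    linear_combination t * (v 0 * e0 + v 1 * e1 + v 2 * e2)
  obtain ⟨l, hl⟩ := Function.ne_iff.1 hcross
  let e : Fin 3 → k := Pi.single l 1
  refine ⟨!![w 0, P 0, e 0; w 1, P 1, e 1; w 2, P 2, e 2], ?_, fun x y => ?_⟩
  · rw [isUnit_iff_ne_zero]
    rw [cross_apply] at hl
    intro h
    apply hl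
    rw [Matrix.det_fin_three] at h
    fin_cases l <;> simp [e] at h ⊢ <;> linear_combination h
  · simp only [eval_linearSubst, eval_ternaryCubic, Matrix.mulVec, dotProduct, Fin.sum_univ_three,
      Matrix.of_apply, Matrix.cons_val]
    refine mul_left_cancel₀ h2 ?_
    linear_combination 2 * y ^ 3 * hFP + x ^ 2 * y * (w 0 * e0 + w 1 * e1 + w 2 * e2)
      + x * y ^ 2 * (P 0 * e0 + P 1 * e1 + P 2 * e2)

theorem exists_linearSubst_eq_projectiveCubic [IsAlgClosed k] (h2 : (2 : k) ≠ 0)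
    {c : ℕ → ℕ → k} (hs : NonsingularCubic (ternaryCubic c))
    (hflex : ∀ x y, eval ![x, y, 0] (ternaryCubic c)
      = x ^ 3 * eval ![1, 0, 0] (ternaryCubic c)) :
    ∃ (M : Matrix (Fin 3) (Fin 3) k) (r α β : k), IsUnit M.det ∧ r ≠ 0 ∧
      linearSubst M (ternaryCubic c) = C r * projectiveCubic α β := by
  have : Infinite k := IsAlgClosed.instInfinite
  simp only [eval_ternaryCubic, Matrix.cons_val] at hflex
  have h03 : c 0 3 = 0 := by simpa using hflex 0 1
  have h12 : c 1 2 = 0 := by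
    refine mul_left_cancel₀ h2 ?_
    linear_combination hflex 1 1 + hflex 1 (-1)
  have h21 : c 2 1 = 0 := by linear_combination hflex 1 1 - h12 - h03
  have hg : c 0 2 ≠ 0 := by
    intro hg
    have := hs ![0, 1, 0] (by simp [eval_ternaryCubic, h03]) fun v => by
      simp only [eval_ternaryCubic, Pi.add_apply, Pi.sub_apply, Matrix.cons_val]
      linear_combination 6 * v 1 * h03 + 2 * v 0 * h12 + 2 * v 2 * hg
    simpa using congrFun this 1
  have ha : c 3 0 ≠ 0 := by
    intro ha
    obtain ⟨y, hy⟩ := IsAlgClosed.exists_root (Polynomial.C (c 0 2) * Polynomial.X ^ 2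
      + Polynomial.C (c 1 1) * Polynomial.X + Polynomial.C (c 2 0))
      (by rw [Polynomial.degree_quadratic hg]; decide)
    simp only [Polynomial.IsRoot.def, Polynomial.eval_add, Polynomial.eval_mul, Polynomial.eval_C,
      Polynomial.eval_pow, Polynomial.eval_X] at hy
    have := hs ![1, y, 0] (by simp [eval_ternaryCubic, h03, h12, h21, ha]) fun v => by
      simp only [eval_ternaryCubic, Pi.add_apply, Pi.sub_apply, Matrix.cons_val, h03, h12, h21, ha]
      linear_combination 2 * v 2 * hy
    simpa using congrFun this 0
  set a := c 3 0
  set g := c 0 2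
  set j := c 1 1
  set i := c 0 1
  obtain ⟨μ, hμ⟩ := IsAlgClosed.exists_pow_nat_eq (-a / g) (n := 2) (by norm_num)
  have hμ0 : μ ≠ 0 := by
    rintro rfl
    rw [zero_pow two_ne_zero, eq_comm, div_eq_zero_iff, neg_eq_zero] at hμ
    exact hμ.elim ha hg
  rw [eq_div_iff hg] at hμ
  obtain ⟨s, hs'⟩ : ∃ s, 2 * g * s = 1 := ⟨(2 * g)⁻¹, mul_inv_cancel₀ (mul_ne_zero h2 hg)⟩
  set e' := c 2 0 - g * (j * s) ^ 2 with he
  set h' := c 1 0 - 2 * g * (j * s) * (i * s) with hh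
  set c' := c 0 0 - g * (i * s) ^ 2 with hc
  obtain ⟨ρ, hρ⟩ := IsAlgClosed.exists_root (Polynomial.C a * Polynomial.X ^ 3
      + Polynomial.C e' * Polynomial.X ^ 2 + Polynomial.C h' * Polynomial.X + Polynomial.C c')
      (by rw [Polynomial.degree_cubic ha]; decide)
  simp only [Polynomial.IsRoot.def, Polynomial.eval_add, Polynomial.eval_mul, Polynomial.eval_C,
    Polynomial.eval_pow, Polynomial.eval_X] at hρ
  obtain ⟨α, hα⟩ : ∃ α, a * α = 3 * a * ρ + e' := ⟨_, mul_div_cancel₀ _ ha⟩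
  obtain ⟨β, hβ⟩ : ∃ β, a * β = 3 * a * ρ ^ 2 + 2 * e' * ρ + h' := ⟨_, mul_div_cancel₀ _ ha⟩
  refine ⟨!![1, 0, ρ; -(j * s), μ, -((j * ρ + i) * s); 0, 0, 1], -a, α, β, ?_, neg_ne_zero.2 ha,
    MvPolynomial.funext fun x => ?_⟩
  · rw [isUnit_iff_ne_zero, Matrix.det_fin_three]
    simpa using hμ0
  · simp only [eval_linearSubst, eval_ternaryCubic, Matrix.mulVec, dotProduct, Fin.sum_univ_three,
      Matrix.of_apply, Matrix.cons_val, projectiveCubic, map_sub, map_add, map_mul, map_pow,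
      eval_X, eval_C, h03, h12, h21]
    rw [he] at hα hρ hβ
    rw [hh] at hρ hβ
    rw [hc] at hρ
    linear_combination x 2 ^ 3 * hρ - x 0 ^ 2 * x 2 * hα - x 0 * x 2 ^ 2 * hβ
      + x 1 ^ 2 * x 2 * hμ + x 2 * (s * (j * (x 0 + ρ * x 2) + i * x 2) ^ 2
        - μ * x 1 * (j * (x 0 + ρ * x 2) + i * x 2)) * hs'

theorem projectiveCubic_discriminant_ne_zero (h2 : (2 : k) ≠ 0) {r α β : k}
    (h : NonsingularCubic (C r * projectiveCubic α β)) : β ≠ 0 ∧ α ^ 2 ≠ 4 * β := by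
  have hne (γ : k) : ¬ (α = 2 * γ ∧ β = γ ^ 2) := by
    rintro ⟨rfl, rfl⟩
    have := h ![-γ, 0, 1] (by
      simp only [projectiveCubic, map_mul, map_sub, map_add, map_pow, eval_C, eval_X,
        Matrix.cons_val]
      ring) fun v => by
      simp only [projectiveCubic, map_mul, map_sub, map_add, map_pow, eval_C, eval_X, Pi.add_apply,
        Pi.sub_apply, Matrix.cons_val]
      ring
    simpa using congrFun this 2
  constructor
  · rintro rfl
    have := h ![0, 0, 1] (by simp [projectiveCubic]) fun v => by
      simp only [projectiveCubic, map_mul, map_sub, map_add, map_pow, eval_C, eval_X, Pi.add_apply,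
        Pi.sub_apply, Matrix.cons_val]
      ring
    simpa using congrFun this 2
  · intro hαβ
    refine hne (α / 2) ⟨(mul_div_cancel₀ α h2).symm, ?_⟩
    rw [div_pow, hαβ, eq_div_iff (pow_ne_zero 2 h2)]
    ring

theorem noLowDegreeSyzygy_of_nonsingularCubic [IsAlgClosed k] (p : ℕ) [Fact p.Prime] [CharP k p]
    (h2 : (2 : k) ≠ 0) {F : MvPolynomial (Fin 3) k} (hF : F.IsHomogeneous 3)
    (hs : NonsingularCubic F) : NoLowDegreeSyzygy p F := by
  obtain ⟨M, hM, hflex⟩ := exists_flex h2 hF hs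
  obtain ⟨c, hc⟩ := exists_eq_ternaryCubic (isHomogeneous_linearSubst hF M)
  have hs' := hs.linearSubst hM
  refine NoLowDegreeSyzygy.of_linearSubst hM ?_
  rw [hc] at hflex hs' ⊢
  obtain ⟨N, r, α, β, hN, hr, h⟩ := exists_linearSubst_eq_projectiveCubic h2 hs' hflex
  have hs'' := hs'.linearSubst hN
  rw [h] at hs''
  obtain ⟨hβ, hαβ⟩ := projectiveCubic_discriminant_ne_zero h2 hs''
  refine NoLowDegreeSyzygy.of_linearSubst hN ?_
  rw [h]
  exact (noLowDegreeSyzygy_projectiveCubic p h2 hβ hαβ).C_mul hr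

end normalForm

/-- **No low-degree syzygies for elliptic curves in odd characteristic.**
Let `k` be algebraically closed of odd characteristic `p` and let `f ∈ k[x,y]` be a cubic
whose homogenization `F ∈ k[x,y,z]` defines a smooth curve (i.e. `F` is homogeneous of
degree `3`, specializes to `f` at `z = 1`, and `F` and its partial derivatives have no
common zero but the origin).  If `q = pⁿ` and `u, v, w ∈ k[x,y]` have degree at most
`(q−1)/2` and `f ∣ u·x^q + v·y^q + w`, then `f` divides each of `u, v, w`. -/
theorem elliptic_curve_no_low_degree_syzygy
    (k : Type*) [Field k] [IsAlgClosed k] (p : ℕ) [Fact p.Prime] [CharP k p]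
    (hodd : Odd p)
    (f : MvPolynomial (Fin 2) k) (hdeg : f.totalDegree = 3)
    (F : MvPolynomial (Fin 3) k) (hF : F.IsHomogeneous 3)
    (hFf : aeval ![(X 0 : MvPolynomial (Fin 2) k), X 1, 1] F = f)
    (hsmooth : ∀ a : Fin 3 → k,
      eval a F = 0 → (∀ i : Fin 3, eval a (pderiv i F) = 0) → a = 0)
    (n : ℕ) (u v w : MvPolynomial (Fin 2) k)
    (hu : u.totalDegree ≤ (p ^ n - 1) / 2)
    (hv : v.totalDegree ≤ (p ^ n - 1) / 2)
    (hw : w.totalDegree ≤ (p ^ n - 1) / 2)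
    (hdvd : f ∣ u * X 0 ^ p ^ n + v * X 1 ^ p ^ n + w) :
    f ∣ u ∧ f ∣ v ∧ f ∣ w := by
  have : Infinite k := IsAlgClosed.instInfinite
  have h2 : (2 : k) ≠ 0 := by
    refine Ring.two_ne_zero ?_
    rw [ringChar.eq k p]
    rintro rfl
    exact absurd hodd (by decide)
  change dehomogenize F = f at hFf
  subst hFf
  obtain ⟨U, hU, rfl⟩ := exists_isHomogeneous_dehomogenize_eq hu
  obtain ⟨V, hV, rfl⟩ := exists_isHomogeneous_dehomogenize_eq hv
  obtain ⟨W, hW, rfl⟩ := exists_isHomogeneous_dehomogenize_eq hw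
  have hd : 2 * ((p ^ n - 1) / 2) < p ^ n := by
    have := pow_pos (Fact.out : p.Prime).pos n
    omega
  have hX (i : Fin 3) : (X i ^ p ^ n : MvPolynomial (Fin 3) k).IsHomogeneous (p ^ n) :=
    isHomogeneous_X_pow i _
  have hFH : F ∣ ∑ i, ![U, V, W] i * X i ^ p ^ n := by
    refine dvd_of_dehomogenize_dvd hF (b := (p ^ n - 1) / 2 + p ^ n)
      (IsHomogeneous.sum _ _ _ fun i _ => IsHomogeneous.mul ?_ (hX i))
      (not_X_two_dvd_of_totalDegree_dehomogenize hF hdeg) ?_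
    · fin_cases i <;> assumption
    · simpa [Fin.sum_univ_three, dehomogenize_X_zero, dehomogenize_X_one, dehomogenize_X_two]
        using hdvd
  have h := noLowDegreeSyzygy_of_nonsingularCubic p h2 hF
    (nonsingularCubic_of_pderiv h2 hF hsmooth) n _ hd ![U, V, W]
    (fun i => by fin_cases i <;> assumption) hFH
  exact ⟨map_dvd _ (h 0), map_dvd _ (h 1), map_dvd _ (h 2)⟩
end
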